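/- arXiv:1907.05810 — 3 statements merged into one kernel-verified Lean document; each statement's English description precedes it below -/
import Mathlib

section
/- For all r₁, r₂ ∈ {0, 1, 2}, as ℓ → ∞ over positive integers, ∫₀^{π/2} [P_ℓ^{(r₁)}(cos φ)·sin^{r₁} φ]² · [P_ℓ^{(r₂)}(cos φ)·sin^{r₂} φ]² · sin φ dφ = ((2 + (−1)^{r₁+r₂})/(2π²))·ℓ^{2(r₁+r₂)−2}·log ℓ + O(ℓ^{2(r₁+r₂)−2}). -/
open Real

/-- The `ℓ`-th Legendre polynomial via Rodrigues' formula: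
`P_ℓ(x) = (1/(2^ℓ ℓ!)) (d/dx)^ℓ (x²−1)^ℓ`. -/
noncomputable def legendreP (l : ℕ) (x : ℝ) : ℝ :=
  (1 / (2 ^ l * (Nat.factorial l : ℝ))) * iteratedDeriv l (fun y => (y ^ 2 - 1) ^ l) x

open Polynomial in
lemma aux_iter (p : ℝ[X]) (r : ℕ) :
    iteratedDeriv r (fun x => p.eval x) = fun x => (derivative^[r] p).eval x := by
  induction r with
  | zero => simp [iteratedDeriv_zero]
  | succ n ih =>
    rw [iteratedDeriv_succ, ih]
    funext x
    rw [Polynomial.deriv, Function.iterate_succ_apply']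

open Polynomial in
/-- the Legendre polynomial as an element of `ℝ[X]` -/
noncomputable def legQ (l : ℕ) : ℝ[X] :=
  C (1 / (2 ^ l * (Nat.factorial l : ℝ))) * derivative^[l] ((X ^ 2 - 1) ^ l)

open Polynomial in
lemma legQ_eval (l : ℕ) : legendreP l = fun x => (legQ l).eval x := by
  funext x
  have h : (fun y : ℝ => (y ^ 2 - 1) ^ l) = fun y => ((X ^ 2 - 1 : ℝ[X]) ^ l).eval y := by
    funext y; simp
  rw [legendreP, h, aux_iter, legQ, eval_mul, eval_C]

open Polynomial in
lemma w_ode (l n : ℕ) :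
    (X ^ 2 - 1) * derivative^[n + 2] ((X ^ 2 - 1 : ℝ[X]) ^ l)
      + C (2 * ((n : ℝ) + 1 - l)) * X * derivative^[n + 1] ((X ^ 2 - 1 : ℝ[X]) ^ l)
      + C (((n : ℝ) + 1) * (n - 2 * l)) * derivative^[n] ((X ^ 2 - 1 : ℝ[X]) ^ l) = 0 := by
  have hC2 : (C 2 : ℝ[X]) = 2 := map_ofNat C 2
  induction n with
  | zero =>
    have h1 : (X ^ 2 - 1) * derivative ((X ^ 2 - 1 : ℝ[X]) ^ l)
        = C (2 * (l : ℝ)) * X * (X ^ 2 - 1 : ℝ[X]) ^ l := by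
      cases l with
      | zero => simp
      | succ k =>
        rw [derivative_pow]
        simp only [derivative_sub, derivative_X_pow, derivative_one, C_mul, C_eq_natCast]
        simp [hC2]
        ring
    have h2 := congrArg derivative h1
    simp only [derivative_mul, derivative_sub, derivative_X_pow, derivative_one, derivative_C,
      derivative_X] at h2
    simp only [Function.iterate_succ_apply', Function.iterate_zero_apply]
    simp only [C_mul, C_add, C_sub, C_eq_natCast] at h2 ⊢
    simp [hC2] at h2 ⊢
    linear_combination h2
  | succ n ih =>
    have h2 := congrArg derivative ih
    simp only [derivative_mul, derivative_add, derivative_sub, derivative_X_pow, derivative_one,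
      derivative_C, derivative_X, derivative_zero] at h2
    simp only [Function.iterate_succ_apply'] at h2 ⊢
    simp only [C_mul, C_add, C_sub, C_eq_natCast] at h2 ⊢
    simp [hC2] at h2 ⊢
    linear_combination h2

open Polynomial in
lemma legQ_ode (l : ℕ) (x : ℝ) :
    (1 - x ^ 2) * (derivative^[2] (legQ l)).eval x - 2 * x * (derivative^[1] (legQ l)).eval x
      + (l : ℝ) * (l + 1) * (legQ l).eval x = 0 := by
  have h := congrArg (eval x) (w_ode l l)
  simp only [legQ, iterate_derivative_C_mul, ← Function.iterate_add_apply]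
  rw [add_comm 2 l, add_comm 1 l]
  simp only [eval_add, eval_mul, eval_sub, eval_pow, eval_X, eval_C, eval_one, eval_zero] at h ⊢
  linear_combination (-(1 / (2 ^ l * (Nat.factorial l : ℝ)))) * h

open Polynomial in
lemma legQ_one (l : ℕ) : (legQ l).eval 1 = 1 := by
  have h : (derivative^[l] ((X ^ 2 - 1 : ℝ[X]) ^ l)).eval 1 = (Nat.factorial l : ℝ) * 2 ^ l := by
    rw [← Polynomial.factorial_smul_hasseDeriv]
    rw [LinearMap.smul_apply, eval_smul, ← taylor_coeff, taylor_pow]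
    have : taylor (1 : ℝ) (X ^ 2 - 1) = X * (X + C 2) := by
      rw [map_sub, taylor_X_pow, taylor_one]
      have : (C 2 : ℝ[X]) = C 1 + C 1 := by rw [← C_add]; norm_num
      rw [this, C_1]; ring
    rw [this, mul_pow]
    have := coeff_X_pow_mul ((X + C (2 : ℝ)) ^ l) l 0
    rw [zero_add] at this
    rw [this, coeff_X_add_C_pow]
    simp
  rw [legQ, eval_mul, h, eval_C]
  field_simp

open Polynomial in
lemma w_coeff (l k : ℕ) : ((X ^ 2 - 1 : ℝ[X]) ^ l).coeff (2 * k) = (-1) ^ (l - k) * (l.choose k : ℝ) := by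
  have : ((X ^ 2 - 1 : ℝ[X]) ^ l) = expand ℝ 2 ((X + C (-1)) ^ l) := by
    simp [sub_eq_add_neg]
  rw [this, mul_comm 2 k, coeff_expand_mul (by norm_num), coeff_X_add_C_pow]

open Polynomial in
lemma w_coeff_odd (l k : ℕ) : ((X ^ 2 - 1 : ℝ[X]) ^ l).coeff (2 * k + 1) = 0 := by
  have : ((X ^ 2 - 1 : ℝ[X]) ^ l) = expand ℝ 2 ((X + C (-1)) ^ l) := by
    simp [sub_eq_add_neg]
  rw [this, coeff_expand (by norm_num), if_neg (by omega)]

open Polynomial in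
lemma legQ_zero (l : ℕ) : (legQ l).eval 0 = ((X ^ 2 - 1 : ℝ[X]) ^ l).coeff l / 2 ^ l := by
  rw [← coeff_zero_eq_eval_zero, legQ, coeff_C_mul, coeff_iterate_derivative]
  simp [Nat.descFactorial_self]
  field_simp

open Polynomial in
lemma legQ_deriv_zero (l : ℕ) : (derivative^[1] (legQ l)).eval 0 =
    (l + 1) * ((X ^ 2 - 1 : ℝ[X]) ^ l).coeff (l + 1) / 2 ^ l := by
  rw [← coeff_zero_eq_eval_zero, legQ, iterate_derivative_C_mul, ← Function.iterate_add_apply,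
    coeff_C_mul, coeff_iterate_derivative]
  rw [zero_add, Nat.descFactorial_self, add_comm 1 l, Nat.factorial_succ]
  simp
  field_simp

lemma central_bounds (n : ℕ) :
    2 / (π * (2 * n + 1)) ≤ ((Nat.choose (2 * n) n : ℝ) / 2 ^ (2 * n)) ^ 2 ∧
    ((Nat.choose (2 * n) n : ℝ) / 2 ^ (2 * n)) ^ 2 ≤ 2 * (2 * n + 2) / (π * (2 * n + 1) ^ 2) := by
  have hc : (Nat.choose (2 * n) n : ℝ) = (Nat.factorial (2 * n) : ℝ) / ((Nat.factorial n : ℝ) ^ 2) := by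
    rw [Nat.cast_choose ℝ (by omega : n ≤ 2 * n)]
    congr 1
    rw [show 2 * n - n = n by omega]; ring
  have hW : ((Nat.choose (2 * n) n : ℝ) / 2 ^ (2 * n)) ^ 2 = 1 / (Wallis.W n * (2 * n + 1)) := by
    rw [Wallis.W_eq_factorial_ratio, hc, show 4 * n = 2 * n * 2 by ring, pow_mul 2 (2 * n) 2]
    have h1 : (Nat.factorial (2 * n) : ℝ) ≠ 0 := by positivity
    have h2 : (Nat.factorial n : ℝ) ≠ 0 := by positivity
    have h3 : (2 * (n : ℝ) + 1) ≠ 0 := by positivity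
    field_simp
  have hp := pi_pos
  have hpos := Wallis.W_pos n
  have h1 := Wallis.W_le n
  have h2 := Wallis.le_W n
  rw [hW]
  have hn : (0 : ℝ) ≤ n := Nat.cast_nonneg n
  constructor
  · rw [div_le_div_iff₀ (by positivity) (by positivity)]
    nlinarith
  · rw [div_le_div_iff₀ (by positivity) (by positivity)]
    have h3 : ((2 : ℝ) * n + 1) * (π / 2) ≤ Wallis.W n * (2 * n + 2) := by
      rw [div_mul_eq_mul_div, div_le_iff₀ (by positivity)] at h2
      exact h2
    have : 0 < (2 * (n : ℝ) + 1) := by positivity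
    nlinarith [mul_le_mul_of_nonneg_right h3 this.le]

open Polynomial in
lemma legQ_energy (l : ℕ) :
    2 * (l : ℝ) / π ≤ (derivative^[1] (legQ l)).eval 0 ^ 2 + (l : ℝ) * (l + 1) * (legQ l).eval 0 ^ 2 ∧
    (derivative^[1] (legQ l)).eval 0 ^ 2 + (l : ℝ) * (l + 1) * (legQ l).eval 0 ^ 2
      ≤ 2 * ((l : ℝ) + 2) / π := by
  have hp := pi_pos
  rw [legQ_zero, legQ_deriv_zero]
  obtain ⟨n, hn | hn⟩ := Nat.even_or_odd' l
  · subst hn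
    rw [w_coeff_odd, w_coeff]
    obtain ⟨h1, h2⟩ := central_bounds n
    set c := ((Nat.choose (2 * n) n : ℝ) / 2 ^ (2 * n)) with hc
    have e : ((-1 : ℝ) ^ (2 * n - n) * (Nat.choose (2 * n) n : ℝ) / 2 ^ (2 * n)) ^ 2 = c ^ 2 := by
      rw [mul_div_assoc, mul_pow, ← hc, ← pow_mul, mul_comm _ 2, pow_mul]; simp
    rw [e]
    have hn : (0 : ℝ) ≤ n := Nat.cast_nonneg n
    push_cast
    rw [div_le_iff₀ (by positivity)] at h1
    rw [le_div_iff₀ (by positivity)] at h2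
    constructor
    · rw [div_le_iff₀ hp]
      nlinarith
    · rw [le_div_iff₀ hp]
      have h3 : 0 < 2 * (n : ℝ) + 1 := by positivity
      have : (2 * (n : ℝ) + 1) * ((2 * n * (2 * n + 1) * c ^ 2) * π) ≤ (2 * (n : ℝ) + 1) * (2 * (2 * n + 2)) := by
        nlinarith
      have := le_of_mul_le_mul_left this h3
      simp only [mul_zero, zero_div]
      nlinarith
  · subst hn
    rw [w_coeff_odd, show 2 * n + 1 + 1 = 2 * (n + 1) by ring, w_coeff]
    obtain ⟨h1, h2⟩ := central_bounds n
    have hn : (0 : ℝ) ≤ n := Nat.cast_nonneg n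
    have hch : ((n : ℝ) + 1) * (Nat.choose (2 * n + 1) (n + 1) : ℝ) = (2 * n + 1) * Nat.choose (2 * n) n := by
      have := Nat.add_one_mul_choose_eq (2 * n) n
      have := congrArg (Nat.cast : ℕ → ℝ) this
      push_cast at this
      linarith
    set c := ((Nat.choose (2 * n) n : ℝ) / 2 ^ (2 * n)) with hc
    have e : (((2 * n + 1 : ℕ) + 1 : ℝ) * ((-1 : ℝ) ^ (2 * n + 1 - (n + 1)) * (Nat.choose (2 * n + 1) (n + 1) : ℝ)) / 2 ^ (2 * n + 1)) ^ 2 = (2 * n + 1) ^ 2 * c ^ 2 := by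
      have : (((2 * n + 1 : ℕ) + 1 : ℝ) * ((-1 : ℝ) ^ (2 * n + 1 - (n + 1)) * (Nat.choose (2 * n + 1) (n + 1) : ℝ)) / 2 ^ (2 * n + 1)) = (-1) ^ (2 * n + 1 - (n + 1)) * ((2 * n + 1) * c) := by
        rw [hc, ← mul_div_assoc, ← hch, pow_succ (2 : ℝ) (2 * n)]
        push_cast
        field_simp
        ring
      rw [this, mul_pow, ← pow_mul, mul_comm _ 2, pow_mul]; ring_nf
    rw [e]
    push_cast
    rw [div_le_iff₀ (by positivity)] at h1
    rw [le_div_iff₀ (by positivity)] at h2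
    have h3 : (0 : ℝ) < 2 * n + 1 := by positivity
    rw [zero_div, zero_pow two_ne_zero, mul_zero, add_zero]
    constructor
    · rw [div_le_iff₀ hp]
      nlinarith [mul_le_mul_of_nonneg_left h1 h3.le]
    · rw [le_div_iff₀ hp]
      nlinarith

lemma pt_fg (f g M : ℝ) (hM : 0 < M) : M * |f * g| ≤ (g ^ 2 + M ^ 2 * f ^ 2) / 2 := by
  rw [abs_mul]
  have h1 := sq_nonneg (|g| - M * |f|)
  have h2 := sq_abs f
  have h3 := sq_abs g
  nlinarith

section core

variable (f g : ℝ → ℝ) (M : ℝ)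

/-- the energy -/
noncomputable def Hen (φ : ℝ) : ℝ := g φ ^ 2 + M ^ 2 * f φ ^ 2
/-- the corrected energy -/
noncomputable def Gen (φ : ℝ) : ℝ := sin φ * Hen f g M φ + cos φ * (f φ * g φ)

lemma Hen_nonneg (φ : ℝ) : 0 ≤ Hen f g M φ := by unfold Hen; positivity

lemma Gen_deriv (φ : ℝ) (hs : sin φ ≠ 0) (hf : HasDerivAt f (g φ) φ)
    (hg : HasDerivAt g (-(cos φ / sin φ) * g φ - M ^ 2 * f φ) φ) :
    HasDerivAt (Gen f g M) (-(f φ * g φ) / sin φ) φ := by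
  unfold Gen Hen
  have h := ((hasDerivAt_sin φ).mul ((hg.pow 2).add ((hf.pow 2).const_mul (M ^ 2)))).add
    ((hasDerivAt_cos φ).mul (hf.mul hg))
  refine h.congr_deriv ?_
  have := sin_sq_add_cos_sq φ
  simp
  field_simp
  linear_combination (-(f φ * g φ)) * this

lemma Gen_sub (φ : ℝ) (hM : 0 < M) :
    |Gen f g M φ - sin φ * Hen f g M φ| ≤ Hen f g M φ / (2 * M) := by
  have h1 := pt_fg (f φ) (g φ) M hM
  have h2 := abs_cos_le_one φ
  rw [show Gen f g M φ - sin φ * Hen f g M φ = cos φ * (f φ * g φ) by unfold Gen; ring, abs_mul,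
    le_div_iff₀ (by positivity)]
  unfold Hen
  have := mul_le_mul_of_nonneg_right h2 (abs_nonneg (f φ * g φ))
  nlinarith

lemma Gen_ge (φ : ℝ) (hM : 0 < M) (hs : 1 ≤ M * sin φ) :
    sin φ * Hen f g M φ / 2 ≤ Gen f g M φ := by
  have h1 := (abs_le.1 (Gen_sub f g M φ hM)).1
  have h2 := Hen_nonneg f g M φ
  have h3 : Hen f g M φ / (2 * M) ≤ sin φ * Hen f g M φ / 2 := by
    rw [div_le_iff₀ (by positivity)]
    nlinarith
  linarith

lemma cot_deriv (φ : ℝ) (hs : sin φ ≠ 0) :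
    HasDerivAt (fun x => cos x / sin x) (-(1 / sin φ ^ 2)) φ := by
  refine ((hasDerivAt_cos φ).div (hasDerivAt_sin φ) hs).congr_deriv ?_
  have := sin_sq_add_cos_sq φ
  field_simp
  linarith

lemma Gen_deriv_bound (φ : ℝ) (hM : 0 < M) (hs : 1 ≤ M * sin φ) :
    |-(f φ * g φ) / sin φ| ≤ Gen f g M φ * (1 / sin φ ^ 2 / M) := by
  have hsp : 0 < sin φ := by
    by_contra h
    push Not at h
    nlinarith
  have h1 := pt_fg (f φ) (g φ) M hM
  have h2 := Gen_ge f g M φ hM hs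
  unfold Hen at h2
  rw [abs_div, abs_neg, abs_of_pos hsp, show Gen f g M φ * (1 / sin φ ^ 2 / M) = Gen f g M φ / (sin φ ^ 2 * M) by field_simp, div_le_div_iff₀ hsp (by positivity)]
  have : M * |f φ * g φ| * sin φ ≤ Gen f g M φ := by nlinarith
  nlinarith [mul_le_mul_of_nonneg_left this hsp.le]


lemma Gen_near (δ : ℝ) (hM : 0 < M) (hδ0 : 0 < δ)
    (hs : ∀ φ ∈ Set.Icc δ (π / 2), 1 ≤ M * sin φ)
    (hf : ∀ φ ∈ Set.Icc δ (π / 2), HasDerivAt f (g φ) φ)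
    (hg : ∀ φ ∈ Set.Icc δ (π / 2), HasDerivAt g (-(cos φ / sin φ) * g φ - M ^ 2 * f φ) φ)
    (φ : ℝ) (hφ : φ ∈ Set.Icc δ (π / 2)) :
    |Gen f g M φ - Gen f g M (π / 2)| ≤ 2 * Gen f g M (π / 2) / (M * sin φ) := by
  have hsp : ∀ φ ∈ Set.Icc δ (π / 2), 0 < sin φ := by
    intro φ h
    have := hs φ h
    by_contra h'
    push Not at h'
    nlinarith
  have hle : δ ≤ π / 2 := hφ.1.trans hφ.2
  have hend : π / 2 ∈ Set.Icc δ (π / 2) := ⟨hle, le_rfl⟩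
  have d1 : ∀ x ∈ Set.Icc δ (π / 2), HasDerivAt (fun y => Gen f g M y * exp (-(cos y / sin y / M)))
      (exp (-(cos x / sin x / M)) * (-(f x * g x) / sin x + Gen f g M x * (1 / sin x ^ 2 / M))) x := by
    intro x hx
    refine ((Gen_deriv f g M x (hsp x hx).ne' (hf x hx) (hg x hx)).mul
      (((cot_deriv x (hsp x hx).ne').div_const M).neg.exp)).congr_deriv ?_
    simp only [Pi.neg_apply]
    ring
  have d2 : ∀ x ∈ Set.Icc δ (π / 2), HasDerivAt (fun y => Gen f g M y * exp ((cos y / sin y / M)))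
      (exp ((cos x / sin x / M)) * (-(f x * g x) / sin x - Gen f g M x * (1 / sin x ^ 2 / M))) x := by
    intro x hx
    refine ((Gen_deriv f g M x (hsp x hx).ne' (hf x hx) (hg x hx)).mul
      (((cot_deriv x (hsp x hx).ne').div_const M).exp)).congr_deriv ?_
    ring
  have m1 : MonotoneOn (fun y => Gen f g M y * exp (-(cos y / sin y / M))) (Set.Icc δ (π / 2)) := by
    apply monotoneOn_of_deriv_nonneg (convex_Icc _ _)
    · exact fun x hx => (d1 x hx).continuousAt.continuousWithinAt
    · exact fun x hx => (d1 x (interior_subset hx)).differentiableAt.differentiableWithinAt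
    · intro x hx
      have hx := interior_subset hx
      rw [(d1 x hx).deriv]
      have := (abs_le.1 (Gen_deriv_bound f g M x hM (hs x hx))).1
      exact mul_nonneg (exp_pos _).le (by linarith)
  have m2 : AntitoneOn (fun y => Gen f g M y * exp ((cos y / sin y / M))) (Set.Icc δ (π / 2)) := by
    apply antitoneOn_of_deriv_nonpos (convex_Icc _ _)
    · exact fun x hx => (d2 x hx).continuousAt.continuousWithinAt
    · exact fun x hx => (d2 x (interior_subset hx)).differentiableAt.differentiableWithinAt
    · intro x hx
      have hx := interior_subset hx
      rw [(d2 x hx).deriv]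
      have := (abs_le.1 (Gen_deriv_bound f g M x hM (hs x hx))).2
      exact mul_nonpos_of_nonneg_of_nonpos (exp_pos _).le (by linarith)
  have k1 := m1 hφ hend hφ.2
  have k2 := m2 hφ hend hφ.2
  simp only [cos_pi_div_two, zero_div, neg_zero, exp_zero, mul_one] at k1 k2
  have hG0 : 0 ≤ Gen f g M (π / 2) := by
    have := Gen_ge f g M (π / 2) hM (hs _ hend)
    have h2 := mul_nonneg (hsp _ hend).le (Hen_nonneg f g M (π / 2))
    linarith
  have hsφ := hsp φ hφ
  have hc0 : 0 ≤ cos φ := cos_nonneg_of_mem_Icc ⟨by linarith [hφ.1, pi_pos], hφ.2⟩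
  have hx0 : 0 ≤ cos φ / sin φ / M := by positivity
  have hx1 : cos φ / sin φ / M ≤ 1 / (M * sin φ) := by
    rw [div_div, mul_comm]
    exact div_le_div_of_nonneg_right (cos_le_one φ) (by positivity)
  have hx2 : 1 / (M * sin φ) ≤ 1 := by
    rw [div_le_one (by positivity)]; exact hs φ hφ
  set x := cos φ / sin φ / M
  set G := Gen f g M φ
  set G0 := Gen f g M (π / 2)
  have e1 := Real.abs_exp_sub_one_le (x := x) (by rw [abs_of_nonneg hx0]; linarith)
  rw [abs_of_nonneg hx0] at e1
  have e2 := (abs_le.1 e1).2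
  have e3 : 1 - x ≤ exp (-x) := by linarith [add_one_le_exp (-x)]
  have p1 : G ≤ G0 * exp x := by
    have := mul_le_mul_of_nonneg_right k1 (exp_pos x).le
    rwa [mul_assoc, ← exp_add, neg_add_cancel, exp_zero, mul_one] at this
  have p2 : G0 * exp (-x) ≤ G := by
    have := mul_le_mul_of_nonneg_right k2 (exp_pos (-x)).le
    rwa [mul_assoc G, ← exp_add, add_neg_cancel, exp_zero, mul_one] at this
  rw [show 2 * G0 / (M * sin φ) = 2 * G0 * (1 / (M * sin φ)) by ring]
  have q1 := mul_le_mul_of_nonneg_left hx1 hG0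
  rw [abs_le]
  constructor
  · have := mul_le_mul_of_nonneg_left e3 hG0
    nlinarith [mul_nonneg hG0 hx0]
  · have := mul_le_mul_of_nonneg_left e2 hG0
    nlinarith

/-- pointwise consequences: `H ≤ 6 G₀ / sin`, and `sin H² ≈ G₀² / sin`. -/
lemma pointwise_est (δ : ℝ) (hM : 0 < M) (hδ0 : 0 < δ)
    (hs : ∀ φ ∈ Set.Icc δ (π / 2), 1 ≤ M * sin φ)
    (hf : ∀ φ ∈ Set.Icc δ (π / 2), HasDerivAt f (g φ) φ)
    (hg : ∀ φ ∈ Set.Icc δ (π / 2), HasDerivAt g (-(cos φ / sin φ) * g φ - M ^ 2 * f φ) φ)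
    (φ : ℝ) (hφ : φ ∈ Set.Icc δ (π / 2)) :
    0 < sin φ ∧ 0 ≤ Gen f g M (π / 2) ∧ sin φ * Hen f g M φ ≤ 6 * Gen f g M (π / 2) ∧
    |sin φ * Hen f g M φ ^ 2 - Gen f g M (π / 2) ^ 2 / sin φ|
      ≤ 35 * (Gen f g M (π / 2) ^ 2 / (M * sin φ ^ 2)) := by
  have h1 := Gen_near f g M δ hM hδ0 hs hf hg φ hφ
  have h2 := Gen_ge f g M φ hM (hs φ hφ)
  have h3 := Gen_sub f g M φ hM
  have hend : π / 2 ∈ Set.Icc δ (π / 2) := ⟨hφ.1.trans hφ.2, le_rfl⟩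
  have hH := Hen_nonneg f g M φ
  have hG0 : 0 ≤ Gen f g M (π / 2) := by
    have := Gen_ge f g M (π / 2) hM (hs _ hend)
    rw [sin_pi_div_two] at this
    have := Hen_nonneg f g M (π / 2)
    linarith
  have hsφ := hs φ hφ
  have hsp : 0 < sin φ := by
    by_contra h'
    push Not at h'
    nlinarith
  set G := Gen f g M φ
  set G0 := Gen f g M (π / 2)
  set H := Hen f g M φ
  have hT : 2 * G0 / (M * sin φ) ≤ 2 * G0 := div_le_self (by positivity) hsφ
  have hHb : sin φ * H ≤ 6 * G0 := by
    have := (abs_le.1 h1).2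
    linarith
  refine ⟨hsp, hG0, hHb, ?_⟩
  have hd : H / (2 * M) ≤ 3 * G0 / (M * sin φ) := by
    rw [div_le_div_iff₀ (by positivity) (by positivity)]
    nlinarith
  have hdiff : |sin φ * H - G0| ≤ 5 * (G0 / (M * sin φ)) := by
    have a1 : |sin φ * H - G0| ≤ |G - sin φ * H| + |G - G0| := by
      rw [abs_sub_comm G]
      exact abs_sub_le _ _ _
    have e1 : 3 * G0 / (M * sin φ) = 3 * (G0 / (M * sin φ)) := by ring
    have e2 : 2 * G0 / (M * sin φ) = 2 * (G0 / (M * sin φ)) := by ring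
    linarith
  have hnn : 0 ≤ sin φ * H := by positivity
  have e : sin φ * H ^ 2 - G0 ^ 2 / sin φ = (sin φ * H - G0) * (sin φ * H + G0) / sin φ := by
    field_simp; ring
  rw [e, abs_div, abs_of_pos hsp, abs_mul, abs_of_nonneg (by positivity : 0 ≤ sin φ * H + G0),
    div_le_iff₀ hsp]
  calc |sin φ * H - G0| * (sin φ * H + G0) ≤ (5 * (G0 / (M * sin φ))) * (7 * G0) :=
        mul_le_mul hdiff (by linarith) (by positivity) (by positivity)
    _ = _ := by field_simp; ring

lemma pt_D (s H G0 f g M : ℝ) (hs : 0 < s) (hM : 0 < M) (hsM : 1 ≤ M * s) (hH : H = g ^ 2 + M ^ 2 * f ^ 2)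
    (hb : s * H ≤ 6 * G0) :
    |M ^ 2 * (s * (f ^ 3 * g))| ≤ 18 * G0 ^ 2 ∧ |s * (f * g ^ 3)| ≤ 18 * G0 ^ 2 ∧
    |f * g ^ 3| ≤ 18 * (G0 ^ 2 / (M * s ^ 2)) := by
  have h1 := pt_fg f g M hM
  rw [← hH] at h1
  have hH0 : 0 ≤ H := by rw [hH]; positivity
  have hf2 : M ^ 2 * f ^ 2 ≤ H := by rw [hH]; nlinarith [sq_nonneg g]
  have hg2 : g ^ 2 ≤ H := by rw [hH]; nlinarith [sq_nonneg (M * f)]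
  have hsH0 : 0 ≤ s * H := by positivity
  have hsq : (s * H) ^ 2 ≤ 36 * G0 ^ 2 := by nlinarith
  have e3 : |f * g ^ 3| = |f * g| * g ^ 2 := by
    rw [show f * g ^ 3 = (f * g) * g ^ 2 by ring, abs_mul, abs_of_nonneg (sq_nonneg g)]
  have k3 : M * |f * g ^ 3| ≤ H ^ 2 / 2 := by
    rw [e3]
    calc M * (|f * g| * g ^ 2) = (M * |f * g|) * g ^ 2 := by ring
      _ ≤ (H / 2) * H := mul_le_mul h1 hg2 (sq_nonneg g) (by positivity)
      _ = _ := by ring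
  have e1 : |M ^ 2 * (s * (f ^ 3 * g))| = s * (|f * g| * (M ^ 2 * f ^ 2)) := by
    rw [show M ^ 2 * (s * (f ^ 3 * g)) = s * ((f * g) * (M ^ 2 * f ^ 2)) by ring, abs_mul, abs_mul,
      abs_of_pos hs, abs_of_nonneg (by positivity : 0 ≤ M ^ 2 * f ^ 2)]
  have k1 : M * (|f * g| * (M ^ 2 * f ^ 2)) ≤ H ^ 2 / 2 := by
    calc M * (|f * g| * (M ^ 2 * f ^ 2)) = (M * |f * g|) * (M ^ 2 * f ^ 2) := by ring
      _ ≤ (H / 2) * H := mul_le_mul h1 hf2 (by positivity) (by positivity)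
      _ = _ := by ring
  have key : ∀ Y : ℝ, 0 ≤ Y → M * Y ≤ H ^ 2 / 2 → s * Y ≤ 18 * G0 ^ 2 := by
    intro Y hY h
    have a1 : s * Y ≤ (M * s) * (s * Y) := le_mul_of_one_le_left (by positivity) hsM
    have a2 := mul_le_mul_of_nonneg_left h (by positivity : 0 ≤ s ^ 2)
    nlinarith
  refine ⟨?_, ?_, ?_⟩
  · rw [e1]
    exact key _ (by positivity) k1
  · rw [abs_mul, abs_of_pos hs]
    exact key _ (abs_nonneg _) k3
  · rw [← mul_div_assoc, le_div_iff₀ (by positivity)]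
    have a2 := mul_le_mul_of_nonneg_left k3 (by positivity : 0 ≤ s ^ 2)
    nlinarith

lemma core_int (δ : ℝ) (hM : 0 < M) (hδ0 : 0 < δ) (hδ1 : δ ≤ π / 2)
    (hs : ∀ φ ∈ Set.Icc δ (π / 2), 1 ≤ M * sin φ)
    (hf : ∀ φ ∈ Set.Icc δ (π / 2), HasDerivAt f (g φ) φ)
    (hg : ∀ φ ∈ Set.Icc δ (π / 2), HasDerivAt g (-(cos φ / sin φ) * g φ - M ^ 2 * f φ) φ)
    (F : ℝ → ℝ) (hFc : ContinuousOn F (Set.Icc δ (π / 2)))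
    (κ α β C1 : ℝ) (hκ : |κ| ≤ 1) (hα : |α| ≤ 1) (hβ : |β| ≤ 1)
    (hF : ∀ φ ∈ Set.Icc δ (π / 2),
      |F φ - (κ * (sin φ * Hen f g M φ ^ 2)
        + α * (sin φ * (3 * M ^ 2 * f φ ^ 2 * g φ ^ 2 - M ^ 4 * f φ ^ 4))
        + β * (sin φ * (g φ ^ 4 - 3 * M ^ 2 * f φ ^ 2 * g φ ^ 2)))|
        ≤ C1 * (Gen f g M (π / 2) ^ 2 / (M * sin φ ^ 2))) (hC1 : 0 ≤ C1) :
    |(∫ φ in δ..(π / 2), F φ) - κ * Gen f g M (π / 2) ^ 2 * ∫ φ in δ..(π / 2), 1 / sin φ|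
      ≤ (C1 + 143) * Gen f g M (π / 2) ^ 2 := by
  have hpt := pointwise_est f g M δ hM hδ0 hs hf hg
  set G0 := Gen f g M (π / 2) with hG0def
  have hu : Set.uIcc δ (π / 2) = Set.Icc δ (π / 2) := Set.uIcc_of_le hδ1
  have hfc : ContinuousOn f (Set.Icc δ (π / 2)) :=
    fun x hx => (hf x hx).continuousAt.continuousWithinAt
  have hgc : ContinuousOn g (Set.Icc δ (π / 2)) :=
    fun x hx => (hg x hx).continuousAt.continuousWithinAt
  have hsc : ContinuousOn sin (Set.Icc δ (π / 2)) := continuous_sin.continuousOn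
  have hcc : ContinuousOn cos (Set.Icc δ (π / 2)) := continuous_cos.continuousOn
  have hs0 : ∀ x ∈ Set.Icc δ (π / 2), sin x ≠ 0 := fun x hx => (hpt x hx).1.ne'
  -- the primitive
  let D : ℝ → ℝ := fun x => α * (M ^ 2 * (sin x * (f x ^ 3 * g x))) + β * (sin x * (f x * g x ^ 3))
  let D' : ℝ → ℝ := fun x => α * (sin x * (3 * M ^ 2 * f x ^ 2 * g x ^ 2 - M ^ 4 * f x ^ 4))
        + β * (sin x * (g x ^ 4 - 3 * M ^ 2 * f x ^ 2 * g x ^ 2) - 2 * cos x * (f x * g x ^ 3))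
  have hD : ∀ x ∈ Set.Icc δ (π / 2), HasDerivAt D (D' x) x := by
    intro x hx
    have hsx := hs0 x hx
    have h1 := ((hasDerivAt_sin x).mul (((hf x hx).pow 3).mul (hg x hx))).const_mul (M ^ 2)
    have h2 := (hasDerivAt_sin x).mul ((hf x hx).mul ((hg x hx).pow 3))
    refine ((h1.const_mul α).add (h2.const_mul β)).congr_deriv ?_
    simp only [D']
    simp
    field_simp
    ring
  have hD'c : ContinuousOn D' (Set.Icc δ (π / 2)) := by
    simp only [D']
    fun_prop
  have hinvc : ContinuousOn (fun x => 1 / sin x) (Set.Icc δ (π / 2)) :=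
    continuousOn_const.div hsc hs0
  have hBc : ContinuousOn (fun x => 1 / sin x ^ 2) (Set.Icc δ (π / 2)) :=
    continuousOn_const.div (hsc.pow 2) (fun x hx => pow_ne_zero 2 (hs0 x hx))
  have iF : IntervalIntegrable F MeasureTheory.volume δ (π / 2) :=
    ContinuousOn.intervalIntegrable (by rwa [hu])
  have iD' : IntervalIntegrable D' MeasureTheory.volume δ (π / 2) :=
    ContinuousOn.intervalIntegrable (by rwa [hu])
  have iinv : IntervalIntegrable (fun x => 1 / sin x) MeasureTheory.volume δ (π / 2) :=
    ContinuousOn.intervalIntegrable (by rwa [hu])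
  have iB : IntervalIntegrable (fun x => 1 / sin x ^ 2) MeasureTheory.volume δ (π / 2) :=
    ContinuousOn.intervalIntegrable (by rwa [hu])
  have ftc : ∫ x in δ..(π / 2), D' x = D (π / 2) - D δ :=
    intervalIntegral.integral_eq_sub_of_hasDerivAt (by rw [hu]; exact hD) iD'
  have ftcB : ∫ x in δ..(π / 2), 1 / sin x ^ 2 = cos δ / sin δ := by
    have := intervalIntegral.integral_eq_sub_of_hasDerivAt (a := δ) (b := π / 2)
      (f := fun x => -(cos x / sin x)) (f' := fun x => 1 / sin x ^ 2)
      (by rw [hu]; intro x hx; exact (cot_deriv x (hs0 x hx)).neg.congr_deriv (by simp)) iB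
    rw [this]; simp
  let R : ℝ → ℝ := fun x => F x - κ * G0 ^ 2 * (1 / sin x) - D' x
  have hR : ∀ x ∈ Set.Icc δ (π / 2), |R x| ≤ (C1 + 71) * (G0 ^ 2 / M) * (1 / sin x ^ 2) := by
    intro x hx
    obtain ⟨hsp, hG0, hb, hd⟩ := hpt x hx
    obtain ⟨-, -, p3⟩ := pt_D (sin x) (Hen f g M x) G0 (f x) (g x) M hsp hM (hs x hx) rfl hb
    have hFx := hF x hx
    have e : R x = (F x - (κ * (sin x * Hen f g M x ^ 2)
        + α * (sin x * (3 * M ^ 2 * f x ^ 2 * g x ^ 2 - M ^ 4 * f x ^ 4))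
        + β * (sin x * (g x ^ 4 - 3 * M ^ 2 * f x ^ 2 * g x ^ 2))))
        + κ * (sin x * Hen f g M x ^ 2 - G0 ^ 2 / sin x) + β * (2 * cos x * (f x * g x ^ 3)) := by
      simp only [R, D']; ring
    have b1 : |κ * (sin x * Hen f g M x ^ 2 - G0 ^ 2 / sin x)| ≤ 35 * (G0 ^ 2 / (M * sin x ^ 2)) := by
      rw [abs_mul]
      calc _ ≤ 1 * |sin x * Hen f g M x ^ 2 - G0 ^ 2 / sin x| :=
            mul_le_mul_of_nonneg_right hκ (abs_nonneg _)
        _ ≤ _ := by linarith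
    have b2 : |β * (2 * cos x * (f x * g x ^ 3))| ≤ 36 * (G0 ^ 2 / (M * sin x ^ 2)) := by
      rw [abs_mul, abs_mul, abs_mul, abs_two]
      calc _ ≤ 1 * (2 * 1 * |f x * g x ^ 3|) := by
            have := abs_cos_le_one x
            gcongr
        _ ≤ _ := by linarith
    have e' : (C1 + 71) * (G0 ^ 2 / M) * (1 / sin x ^ 2) = (C1 + 71) * (G0 ^ 2 / (M * sin x ^ 2)) := by
      field_simp
    rw [e, e']
    refine (abs_add_three _ _ _).trans ?_
    linarith
  have hδm : δ ∈ Set.Icc δ (π / 2) := ⟨le_rfl, hδ1⟩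
  have hend : π / 2 ∈ Set.Icc δ (π / 2) := ⟨hδ1, le_rfl⟩
  have hDb : ∀ x ∈ Set.Icc δ (π / 2), |D x| ≤ 36 * G0 ^ 2 := by
    intro x hx
    obtain ⟨hsp, hG0, hb, hd⟩ := hpt x hx
    obtain ⟨p1, p2, -⟩ := pt_D (sin x) (Hen f g M x) G0 (f x) (g x) M hsp hM (hs x hx) rfl hb
    simp only [D]
    refine (abs_add_le _ _).trans ?_
    rw [abs_mul α, abs_mul β]
    have := mul_le_mul hα p1 (abs_nonneg _) zero_le_one
    have := mul_le_mul hβ p2 (abs_nonneg _) zero_le_one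
    linarith
  have split : (∫ φ in δ..(π / 2), F φ) - κ * G0 ^ 2 * ∫ φ in δ..(π / 2), 1 / sin φ
      = (∫ x in δ..(π / 2), R x) + (D (π / 2) - D δ) := by
    simp only [R]
    rw [← ftc, intervalIntegral.integral_sub (iF.sub (iinv.const_mul _)) iD',
      intervalIntegral.integral_sub iF (iinv.const_mul _), intervalIntegral.integral_const_mul]
    ring
  have hRint : |∫ x in δ..(π / 2), R x| ≤ (C1 + 71) * G0 ^ 2 := by
    have h := intervalIntegral.norm_integral_le_of_norm_le (μ := MeasureTheory.volume) (f := R) hδ1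
      (Filter.Eventually.of_forall (fun x hx => hR x ⟨hx.1.le, hx.2⟩))
      (iB.const_mul ((C1 + 71) * (G0 ^ 2 / M)))
    rw [intervalIntegral.integral_const_mul, ftcB, Real.norm_eq_abs] at h
    refine h.trans ?_
    have hsδ := (hpt δ hδm).1
    have : cos δ / sin δ ≤ M := by
      rw [div_le_iff₀ hsδ]
      linarith [cos_le_one δ, hs δ hδm]
    calc _ ≤ (C1 + 71) * (G0 ^ 2 / M) * M := by gcongr
      _ = _ := by field_simp
  rw [split]
  have := hDb _ hδm
  have := hDb _ hend
  refine (abs_add_le _ _).trans ?_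
  have := abs_sub (D (π / 2)) (D δ)
  linarith

/-- normalised squares -/
noncomputable def Tr (r : ℕ) (f g M s c : ℝ) : ℝ :=
  if r = 0 then M ^ 2 * f ^ 2 else if r = 1 then g ^ 2 else (M * f + 2 * (c / s) * g / M) ^ 2

/-- main part of the normalised squares -/
noncomputable def Ir (r : ℕ) (f g M : ℝ) : ℝ := if r = 1 then g ^ 2 else M ^ 2 * f ^ 2

lemma Tr_nonneg (r : ℕ) (f g M s c : ℝ) : 0 ≤ Tr r f g M s c := by
  unfold Tr; split_ifs <;> positivity

lemma Ir_bd (r : ℕ) (f g M : ℝ) : 0 ≤ Ir r f g M ∧ Ir r f g M ≤ g ^ 2 + M ^ 2 * f ^ 2 := by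
  have h1 := sq_nonneg g
  have h2 : 0 ≤ M ^ 2 * f ^ 2 := by positivity
  unfold Ir; split_ifs <;> constructor <;> linarith

lemma Tr_sub (r : ℕ) (f g M s c : ℝ) (hM : 0 < M) (hs : 0 < s) (hMs : 1 ≤ M * s) (hc : |c| ≤ 1) :
    |Tr r f g M s c - Ir r f g M| ≤ 6 * (g ^ 2 + M ^ 2 * f ^ 2) / (M * s) := by
  have hnn : 0 ≤ 6 * (g ^ 2 + M ^ 2 * f ^ 2) / (M * s) := by positivity
  unfold Tr Ir
  split_ifs with h0 h1
  · omega
  · simpa using hnn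
  · simpa using hnn
  · have e : (M * f + 2 * (c / s) * g / M) ^ 2 - M ^ 2 * f ^ 2
        = (4 * c * s * M ^ 2 * (f * g) + 4 * c ^ 2 * g ^ 2) / (M * s) ^ 2 := by
      field_simp; ring
    rw [e, abs_div, abs_of_nonneg (by positivity : 0 ≤ (M * s) ^ 2), div_le_div_iff₀ (by positivity) (by positivity)]
    have k := pt_fg f g M hM
    have hc2 : c ^ 2 ≤ 1 := (sq_le_one_iff_abs_le_one c).2 hc
    have a1 : |4 * c * s * M ^ 2 * (f * g)| ≤ 2 * (M * s) * (g ^ 2 + M ^ 2 * f ^ 2) := by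
      rw [abs_mul, abs_mul, abs_mul, abs_mul, abs_of_pos hs, abs_of_pos (pow_pos hM 2),
        abs_of_pos (by norm_num : (0 : ℝ) < 4)]
      calc 4 * |c| * s * M ^ 2 * |f * g| = |c| * (4 * s * M * (M * |f * g|)) := by ring
        _ ≤ 1 * (4 * s * M * ((g ^ 2 + M ^ 2 * f ^ 2) / 2)) := by gcongr
        _ = _ := by ring
    have a2 : |4 * c ^ 2 * g ^ 2| ≤ 4 * (M * s) * (g ^ 2 + M ^ 2 * f ^ 2) := by
      rw [abs_of_nonneg (by positivity)]
      calc 4 * c ^ 2 * g ^ 2 ≤ 4 * 1 * (g ^ 2 + M ^ 2 * f ^ 2) := by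
            gcongr
            have : 0 ≤ M ^ 2 * f ^ 2 := by positivity
            linarith
        _ ≤ 4 * (M * s) * (g ^ 2 + M ^ 2 * f ^ 2) := by gcongr
    have a3 := (abs_add_le (4 * c * s * M ^ 2 * (f * g)) (4 * c ^ 2 * g ^ 2)).trans (add_le_add a1 a2)
    have := mul_le_mul_of_nonneg_right a3 (by positivity : 0 ≤ M * s)
    nlinarith

lemma Tr_core (δ : ℝ) (hM : 0 < M) (hδ0 : 0 < δ) (hδ1 : δ ≤ π / 2)
    (hs : ∀ φ ∈ Set.Icc δ (π / 2), 1 ≤ M * sin φ)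
    (hf : ∀ φ ∈ Set.Icc δ (π / 2), HasDerivAt f (g φ) φ)
    (hg : ∀ φ ∈ Set.Icc δ (π / 2), HasDerivAt g (-(cos φ / sin φ) * g φ - M ^ 2 * f φ) φ)
    (r₁ r₂ : ℕ) (hr₁ : r₁ ≤ 2) (hr₂ : r₂ ≤ 2) :
    |(∫ φ in δ..(π / 2), Tr r₁ (f φ) (g φ) M (sin φ) (cos φ) * Tr r₂ (f φ) (g φ) M (sin φ) (cos φ)
        * sin φ)
      - (2 + (-1) ^ (r₁ + r₂)) / 8 * Gen f g M (π / 2) ^ 2 * ∫ φ in δ..(π / 2), 1 / sin φ|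
      ≤ 1871 * Gen f g M (π / 2) ^ 2 := by
  have hpt := pointwise_est f g M δ hM hδ0 hs hf hg
  have hfc : ContinuousOn f (Set.Icc δ (π / 2)) :=
    fun x hx => (hf x hx).continuousAt.continuousWithinAt
  have hgc : ContinuousOn g (Set.Icc δ (π / 2)) :=
    fun x hx => (hg x hx).continuousAt.continuousWithinAt
  have hsc : ContinuousOn sin (Set.Icc δ (π / 2)) := continuous_sin.continuousOn
  have hcc : ContinuousOn cos (Set.Icc δ (π / 2)) := continuous_cos.continuousOn
  have hs0 : ∀ x ∈ Set.Icc δ (π / 2), sin x ≠ 0 := fun x hx => (hpt x hx).1.ne'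
  have hcot := hcc.div hsc hs0
  have hTc : ∀ r, ContinuousOn (fun φ => Tr r (f φ) (g φ) M (sin φ) (cos φ)) (Set.Icc δ (π / 2)) := by
    intro r
    unfold Tr
    split_ifs
    · fun_prop
    · fun_prop
    · exact ((continuousOn_const.mul hfc).add
        (((continuousOn_const.mul hcot).mul hgc).div_const M)).pow 2
  have hαβ : ∃ α β : ℝ, |α| ≤ 1 ∧ |β| ≤ 1 ∧ ∀ f g : ℝ, Ir r₁ f g M * Ir r₂ f g M =
      (2 + (-1) ^ (r₁ + r₂)) / 8 * (g ^ 2 + M ^ 2 * f ^ 2) ^ 2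
      + α * (3 * M ^ 2 * f ^ 2 * g ^ 2 - M ^ 4 * f ^ 4)
      + β * (g ^ 4 - 3 * M ^ 2 * f ^ 2 * g ^ 2) := by
    have pp : ∃ α β : ℝ, |α| ≤ 1 ∧ |β| ≤ 1 ∧ ∀ f g : ℝ, (M ^ 2 * f ^ 2) * (M ^ 2 * f ^ 2) =
      3 / 8 * (g ^ 2 + M ^ 2 * f ^ 2) ^ 2
      + α * (3 * M ^ 2 * f ^ 2 * g ^ 2 - M ^ 4 * f ^ 4)
      + β * (g ^ 4 - 3 * M ^ 2 * f ^ 2 * g ^ 2) :=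
      ⟨-5 / 8, -3 / 8, by norm_num [abs_le], by norm_num [abs_le], fun f g => by ring⟩
    have pq : ∃ α β : ℝ, |α| ≤ 1 ∧ |β| ≤ 1 ∧ ∀ f g : ℝ, (M ^ 2 * f ^ 2) * (g ^ 2) =
      1 / 8 * (g ^ 2 + M ^ 2 * f ^ 2) ^ 2
      + α * (3 * M ^ 2 * f ^ 2 * g ^ 2 - M ^ 4 * f ^ 4)
      + β * (g ^ 4 - 3 * M ^ 2 * f ^ 2 * g ^ 2) :=
      ⟨1 / 8, -1 / 8, by norm_num [abs_le], by norm_num [abs_le], fun f g => by ring⟩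
    have qq : ∃ α β : ℝ, |α| ≤ 1 ∧ |β| ≤ 1 ∧ ∀ f g : ℝ, (g ^ 2) * (g ^ 2) =
      3 / 8 * (g ^ 2 + M ^ 2 * f ^ 2) ^ 2
      + α * (3 * M ^ 2 * f ^ 2 * g ^ 2 - M ^ 4 * f ^ 4)
      + β * (g ^ 4 - 3 * M ^ 2 * f ^ 2 * g ^ 2) :=
      ⟨3 / 8, 5 / 8, by norm_num [abs_le], by norm_num [abs_le], fun f g => by ring⟩
    interval_cases r₁ <;> interval_cases r₂ <;>
      first
      | (obtain ⟨α, β, h1, h2, h⟩ := pp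
         refine ⟨α, β, h1, h2, fun f g => ?_⟩
         have := h f g
         norm_num [Ir]
         linarith)
      | (obtain ⟨α, β, h1, h2, h⟩ := pq
         refine ⟨α, β, h1, h2, fun f g => ?_⟩
         have := h f g
         norm_num [Ir]
         linarith)
      | (obtain ⟨α, β, h1, h2, h⟩ := qq
         refine ⟨α, β, h1, h2, fun f g => ?_⟩
         have := h f g
         norm_num [Ir]
         linarith)
  obtain ⟨α, β, hα, hβ, hab⟩ := hαβ
  have hκ : |(2 + (-1 : ℝ) ^ (r₁ + r₂)) / 8| ≤ 1 := by
    rcases neg_one_pow_eq_or ℝ (r₁ + r₂) with h | h <;> rw [h] <;> norm_num [abs_le]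
  have := core_int f g M δ hM hδ0 hδ1 hs hf hg
    (fun φ => Tr r₁ (f φ) (g φ) M (sin φ) (cos φ) * Tr r₂ (f φ) (g φ) M (sin φ) (cos φ) * sin φ)
    (((hTc r₁).mul (hTc r₂)).mul hsc) ((2 + (-1) ^ (r₁ + r₂)) / 8) α β 1728 hκ hα hβ ?_ (by norm_num)
  · refine this.trans (le_of_eq ?_)
    norm_num
  intro φ hφ
  obtain ⟨hsp, hG0, hb, -⟩ := hpt φ hφ
  have hsφ := hs φ hφ
  set G0 := Gen f g M (π / 2)
  have t1 := Tr_sub r₁ (f φ) (g φ) M (sin φ) (cos φ) hM hsp hsφ (abs_cos_le_one φ)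
  have t2 := Tr_sub r₂ (f φ) (g φ) M (sin φ) (cos φ) hM hsp hsφ (abs_cos_le_one φ)
  have i1 := Ir_bd r₁ (f φ) (g φ) M
  have i2 := Ir_bd r₂ (f φ) (g φ) M
  have n2 := Tr_nonneg r₂ (f φ) (g φ) M (sin φ) (cos φ)
  have hH0 := Hen_nonneg f g M φ
  have key := hab (f φ) (g φ)
  change _ ≤ 6 * Hen f g M φ / (M * sin φ) at t1 t2
  change _ ∧ _ ≤ Hen f g M φ at i1 i2
  change _ = _ * Hen f g M φ ^ 2 + _ + _ at key
  set H := Hen f g M φ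
  set T1 := Tr r₁ (f φ) (g φ) M (sin φ) (cos φ)
  set T2 := Tr r₂ (f φ) (g φ) M (sin φ) (cos φ)
  set I1 := Ir r₁ (f φ) (g φ) M
  set I2 := Ir r₂ (f φ) (g φ) M
  have hT2 : T2 ≤ 7 * H := by
    have h1 := (abs_le.1 t2).2
    have h2 : 6 * H / (M * sin φ) ≤ 6 * H := div_le_self (by positivity) hsφ
    linarith [i2.2]
  have e : T1 * T2 * sin φ - ((2 + (-1) ^ (r₁ + r₂)) / 8 * (sin φ * H ^ 2)
        + α * (sin φ * (3 * M ^ 2 * f φ ^ 2 * g φ ^ 2 - M ^ 4 * f φ ^ 4))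
        + β * (sin φ * (g φ ^ 4 - 3 * M ^ 2 * f φ ^ 2 * g φ ^ 2)))
      = sin φ * ((T1 - I1) * T2 + I1 * (T2 - I2)) := by
    linear_combination (sin φ) * key
  rw [e, abs_mul, abs_of_pos hsp]
  have b : |(T1 - I1) * T2 + I1 * (T2 - I2)| ≤ 48 * H ^ 2 / (M * sin φ) := by
    refine (abs_add_le _ _).trans ?_
    rw [abs_mul, abs_mul, abs_of_nonneg n2, abs_of_nonneg i1.1]
    calc _ ≤ (6 * H / (M * sin φ)) * (7 * H) + H * (6 * H / (M * sin φ)) := by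
          have := i1.2
          gcongr
      _ = _ := by ring
  calc sin φ * |(T1 - I1) * T2 + I1 * (T2 - I2)| ≤ sin φ * (48 * H ^ 2 / (M * sin φ)) := by gcongr
    _ = 48 * ((sin φ * H) ^ 2 / (M * sin φ ^ 2)) := by field_simp
    _ ≤ 48 * ((6 * G0) ^ 2 / (M * sin φ ^ 2)) := by gcongr
    _ = _ := by ring

end core

section near

variable (q q1 q2 : ℝ → ℝ) (L : ℝ)

lemma near_bounds (hL : 0 < L) (h0 : ∀ x, HasDerivAt q (q1 x) x) (h1 : ∀ x, HasDerivAt q1 (q2 x) x)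
    (ode : ∀ x, (1 - x ^ 2) * q2 x - 2 * x * q1 x + L * q x = 0) (hq : q 1 = 1)
    (x : ℝ) (hx : x ∈ Set.Icc (0 : ℝ) 1) :
    |q x| ≤ 1 ∧ (1 - x ^ 2) * q1 x ^ 2 ≤ L ∧ |q1 x| ≤ L := by
  have hone : (1 : ℝ) ∈ Set.Icc (0 : ℝ) 1 := ⟨zero_le_one, le_rfl⟩
  have dV : ∀ x, HasDerivAt (fun y => L * q y ^ 2 + (1 - y ^ 2) * q1 y ^ 2) (2 * x * q1 x ^ 2) x := by
    intro x
    have e := (((h0 x).pow 2).const_mul L).add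
      ((((hasDerivAt_id x).pow 2).const_sub 1).mul ((h1 x).pow 2))
    refine e.congr_deriv ?_
    simp
    linear_combination (2 * q1 x) * ode x
  have mV : MonotoneOn (fun y => L * q y ^ 2 + (1 - y ^ 2) * q1 y ^ 2) (Set.Icc (0 : ℝ) 1) := by
    apply monotoneOn_of_deriv_nonneg (convex_Icc _ _)
    · exact fun x _ => (dV x).continuousAt.continuousWithinAt
    · exact fun x _ => (dV x).differentiableAt.differentiableWithinAt
    · intro x hx
      have hx := interior_subset hx
      rw [(dV x).deriv]
      have := hx.1
      positivity
  have key : ∀ x ∈ Set.Icc (0 : ℝ) 1, |q x| ≤ 1 ∧ (1 - x ^ 2) * q1 x ^ 2 ≤ L := by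
    intro x hx
    have k := mV hx hone hx.2
    simp only [hq] at k
    have hx2 : 0 ≤ 1 - x ^ 2 := by nlinarith [hx.1, hx.2]
    have p1 : 0 ≤ (1 - x ^ 2) * q1 x ^ 2 := by positivity
    have p2 : 0 ≤ L * q x ^ 2 := by positivity
    constructor
    · rw [← sq_le_one_iff_abs_le_one]
      have : L * q x ^ 2 ≤ L * 1 := by nlinarith
      exact le_of_mul_le_mul_left this hL
    · nlinarith
  refine ⟨(key x hx).1, (key x hx).2, ?_⟩
  have dU : ∀ x, HasDerivAt (fun y => (1 - y ^ 2) * q1 y) (-(L * q x)) x := by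
    intro x
    refine ((((hasDerivAt_id x).pow 2).const_sub 1).mul (h1 x)).congr_deriv ?_
    simp
    linear_combination ode x
  have dU1 : ∀ x, HasDerivAt (fun y => (1 - y ^ 2) * q1 y + L * y) (-(L * q x) + L) x := by
    intro x
    refine ((dU x).add ((hasDerivAt_id x).const_mul L)).congr_deriv ?_
    simp
  have dU2 : ∀ x, HasDerivAt (fun y => (1 - y ^ 2) * q1 y - L * y) (-(L * q x) - L) x := by
    intro x
    refine ((dU x).sub ((hasDerivAt_id x).const_mul L)).congr_deriv ?_
    simp
  have m1 : MonotoneOn (fun y => (1 - y ^ 2) * q1 y + L * y) (Set.Icc (0 : ℝ) 1) := by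
    apply monotoneOn_of_deriv_nonneg (convex_Icc _ _)
    · exact fun x _ => (dU1 x).continuousAt.continuousWithinAt
    · exact fun x _ => (dU1 x).differentiableAt.differentiableWithinAt
    · intro x hx
      have hx := interior_subset hx
      rw [(dU1 x).deriv]
      have := (abs_le.1 (key x hx).1).2
      nlinarith
  have m2 : AntitoneOn (fun y => (1 - y ^ 2) * q1 y - L * y) (Set.Icc (0 : ℝ) 1) := by
    apply antitoneOn_of_deriv_nonpos (convex_Icc _ _)
    · exact fun x _ => (dU2 x).continuousAt.continuousWithinAt
    · exact fun x _ => (dU2 x).differentiableAt.differentiableWithinAt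
    · intro x hx
      have hx := interior_subset hx
      rw [(dU2 x).deriv]
      have := (abs_le.1 (key x hx).1).1
      nlinarith
  have k1 := m1 hx hone hx.2
  have k2 := m2 hx hone hx.2
  simp only at k1 k2
  rcases eq_or_lt_of_le hx.2 with h | h
  · have := ode x
    rw [h, hq] at this
    rw [h, abs_le]
    constructor <;> nlinarith
  · have hp : 0 < 1 - x := by linarith
    have hx0 := hx.1
    have a1 : (1 + x) * q1 x ≤ L := by
      refine le_of_mul_le_mul_left ?_ hp
      nlinarith
    have a2 : -L ≤ (1 + x) * q1 x := by
      refine le_of_mul_le_mul_left ?_ hp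
      nlinarith
    have : (1 + x) * |q1 x| ≤ L := by
      rw [← abs_of_nonneg (by linarith : 0 ≤ 1 + x), ← abs_mul]
      exact abs_le.2 ⟨a2, a1⟩
    nlinarith [abs_nonneg (q1 x)]

end near

lemma inv_sin_bounds (x : ℝ) (h0 : 0 < x) (h1 : x ≤ π / 2) : 1 / x ≤ 1 / sin x ∧ 1 / sin x ≤ 1 / x + 1 := by
  have hs : 0 < sin x := sin_pos_of_pos_of_lt_pi h0 (by linarith [pi_pos])
  have hc : 0 ≤ cos x := cos_nonneg_of_mem_Icc ⟨by linarith, h1⟩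
  have hsx := sin_le h0.le
  refine ⟨one_div_le_one_div_of_le hs hsx, ?_⟩
  have hxc : x * cos x ≤ sin x := by
    rcases eq_or_lt_of_le h1 with h | h
    · rw [h]; simp
    · have := le_tan h0.le h
      have hcp : 0 < cos x := cos_pos_of_mem_Ioo ⟨by linarith, h⟩
      rw [tan_eq_sin_div_cos, le_div_iff₀ hcp] at this
      exact this
  have hcs : 1 - cos x ≤ sin x := by
    have := sin_sq_add_cos_sq x
    nlinarith [cos_le_one x, sin_le_one x]
  rw [show 1 / x + 1 = (1 + x) / x by field_simp, div_le_div_iff₀ hs h0]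
  nlinarith

lemma int_inv_sin (δ : ℝ) (h0 : 0 < δ) (h1 : δ ≤ π / 2) :
    log (π / 2 / δ) ≤ ∫ x in δ..(π / 2), 1 / sin x ∧
    ∫ x in δ..(π / 2), 1 / sin x ≤ log (π / 2 / δ) + 2 := by
  have hp := pi_pos
  have hu : Set.uIcc δ (π / 2) = Set.Icc δ (π / 2) := Set.uIcc_of_le h1
  have e : ∫ x in δ..(π / 2), 1 / x = log (π / 2 / δ) := integral_one_div_of_pos h0 (by positivity)
  have i1 : IntervalIntegrable (fun x : ℝ => 1 / x) MeasureTheory.volume δ (π / 2) := by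
    apply ContinuousOn.intervalIntegrable
    rw [hu]
    exact continuousOn_const.div continuousOn_id (fun x hx => (h0.trans_le hx.1).ne')
  have i2 : IntervalIntegrable (fun x : ℝ => 1 / sin x) MeasureTheory.volume δ (π / 2) := by
    apply ContinuousOn.intervalIntegrable
    rw [hu]
    exact continuousOn_const.div continuous_sin.continuousOn
      (fun x hx => (sin_pos_of_pos_of_lt_pi (h0.trans_le hx.1) (by linarith [hx.2])).ne')
  constructor
  · rw [← e]
    exact intervalIntegral.integral_mono_on h1 i1 i2
      (fun x hx => (inv_sin_bounds x (h0.trans_le hx.1) hx.2).1)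
  · have := intervalIntegral.integral_mono_on h1 i2 (i1.add intervalIntegrable_const)
      (fun x hx => (inv_sin_bounds x (h0.trans_le hx.1) hx.2).2)
    rw [intervalIntegral.integral_add i1 intervalIntegrable_const, e] at this
    simp at this
    have := pi_le_four
    simp
    linarith

/-- The quantity `P_l^{(r)}(cos φ) sin^r φ`, in terms of values and derivatives. -/
noncomputable def Ar (r : ℕ) (q q1 q2 : ℝ → ℝ) (φ : ℝ) : ℝ :=
  (if r = 0 then q (cos φ) else if r = 1 then q1 (cos φ) else q2 (cos φ)) * sin φ ^ r

lemma total_int (q q1 q2 : ℝ → ℝ) (M : ℝ) (hM : 1 ≤ M)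
    (h0 : ∀ x, HasDerivAt q (q1 x) x) (h1 : ∀ x, HasDerivAt q1 (q2 x) x) (h2 : Continuous q2)
    (ode : ∀ x, (1 - x ^ 2) * q2 x - 2 * x * q1 x + M ^ 2 * q x = 0) (hq : q 1 = 1)
    (r₁ r₂ : ℕ) (hr₁ : r₁ ≤ 2) (hr₂ : r₂ ≤ 2) :
    ∃ Λ : ℝ, log M ≤ Λ ∧ Λ ≤ log M + 2 ∧
    |(∫ φ in (0 : ℝ)..(π / 2), Ar r₁ q q1 q2 φ ^ 2 * Ar r₂ q q1 q2 φ ^ 2 * sin φ)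
      - ((M ^ 2) ^ (r₁ + r₂) / (M ^ 2) ^ 2) * ((2 + (-1) ^ (r₁ + r₂)) / 8 * (q1 0 ^ 2 + M ^ 2 * q 0 ^ 2) ^ 2 * Λ)|
      ≤ ((M ^ 2) ^ (r₁ + r₂) / (M ^ 2) ^ 2) * (1871 * (q1 0 ^ 2 + M ^ 2 * q 0 ^ 2) ^ 2 + 324 * M ^ 2) := by
  have hp := pi_pos
  have hMp : 0 < M := by linarith
  set δ := π / (2 * M) with hδ
  have hδ0 : 0 < δ := by positivity
  have hδ1 : δ ≤ π / 2 := by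
    rw [hδ]; exact div_le_div_of_nonneg_left hp.le two_pos (by linarith)
  have hlog : π / 2 / δ = M := by rw [hδ]; field_simp
  obtain ⟨l1, l2⟩ := int_inv_sin δ hδ0 hδ1
  rw [hlog] at l1 l2
  refine ⟨_, l1, l2, ?_⟩
  let f : ℝ → ℝ := fun φ => q (cos φ)
  let g : ℝ → ℝ := fun φ => q1 (cos φ) * (-sin φ)
  have hs : ∀ φ ∈ Set.Icc δ (π / 2), 1 ≤ M * sin φ := by
    intro φ hφ
    have := mul_le_sin (hδ0.le.trans hφ.1) hφ.2
    have h3 : M * (2 / π * δ) = 1 := by rw [hδ]; field_simp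
    have h4 : 2 / π * δ ≤ 2 / π * φ := mul_le_mul_of_nonneg_left hφ.1 (by positivity)
    nlinarith
  have hsp : ∀ φ ∈ Set.Icc δ (π / 2), 0 < sin φ := fun φ hφ =>
    sin_pos_of_pos_of_lt_pi (hδ0.trans_le hφ.1) (by linarith [hφ.2])
  have hf : ∀ φ ∈ Set.Icc δ (π / 2), HasDerivAt f (g φ) φ := by
    intro φ _
    exact (h0 (cos φ)).comp φ (hasDerivAt_cos φ)
  have hg : ∀ φ ∈ Set.Icc δ (π / 2), HasDerivAt g (-(cos φ / sin φ) * g φ - M ^ 2 * f φ) φ := by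
    intro φ hφ
    have a := ((h1 (cos φ)).comp φ (hasDerivAt_cos φ)).mul (hasDerivAt_sin φ).neg
    refine a.congr_deriv ?_
    have hs0 := (hsp φ hφ).ne'
    have o := ode (cos φ)
    have sc := sin_sq_add_cos_sq φ
    simp only [f, g]
    simp
    field_simp
    linear_combination o + q2 (cos φ) * sc
  have hG0 : Gen f g M (π / 2) = q1 0 ^ 2 + M ^ 2 * q 0 ^ 2 := by
    simp [Gen, Hen, f, g]
  have hcore := Tr_core f g M δ hMp hδ0 hδ1 hs hf hg r₁ r₂ hr₁ hr₂
  rw [hG0] at hcore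
  set G0 := q1 0 ^ 2 + M ^ 2 * q 0 ^ 2
  set Y := (M ^ 2) ^ (r₁ + r₂) / (M ^ 2) ^ 2 with hY
  have hY0 : 0 ≤ Y := by positivity
  -- link on [δ, π/2]
  have hlink : ∀ r ≤ 2, ∀ φ ∈ Set.Icc δ (π / 2),
      Ar r q q1 q2 φ ^ 2 = (M ^ 2) ^ r / M ^ 2 * Tr r (f φ) (g φ) M (sin φ) (cos φ) := by
    intro r hr φ hφ
    have hs0 := (hsp φ hφ).ne'
    interval_cases r
    · simp [Ar, Tr, f]; field_simp
    · simp [Ar, Tr, g]; field_simp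
    · have o := ode (cos φ)
      have sc := sin_sq_add_cos_sq φ
      have e : q2 (cos φ) * sin φ ^ 2 = 2 * cos φ * q1 (cos φ) - M ^ 2 * q (cos φ) := by
        linear_combination o + q2 (cos φ) * sc
      simp only [Ar, Tr, f, g]
      norm_num
      rw [e]
      field_simp
      ring
  have hint2 : ∫ φ in δ..(π / 2), Ar r₁ q q1 q2 φ ^ 2 * Ar r₂ q q1 q2 φ ^ 2 * sin φ
      = Y * ∫ φ in δ..(π / 2), Tr r₁ (f φ) (g φ) M (sin φ) (cos φ) * Tr r₂ (f φ) (g φ) M (sin φ) (cos φ)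
        * sin φ := by
    rw [← intervalIntegral.integral_const_mul]
    apply intervalIntegral.integral_congr
    intro φ hφ
    rw [Set.uIcc_of_le hδ1] at hφ
    simp only
    rw [hlink r₁ hr₁ φ hφ, hlink r₂ hr₂ φ hφ, hY, pow_add]
    field_simp
  -- near zero
  have hAb : ∀ r ≤ 2, ∀ φ ∈ Set.Icc 0 δ, Ar r q q1 q2 φ ^ 2 ≤ 9 * (M ^ 2) ^ r := by
    intro r hr φ hφ
    have hc0 : 0 ≤ cos φ := cos_nonneg_of_mem_Icc ⟨by linarith [hφ.1], hφ.2.trans hδ1⟩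
    obtain ⟨b1, b2, b3⟩ := near_bounds q q1 q2 (M ^ 2) (by positivity) h0 h1 ode hq (cos φ) ⟨hc0, cos_le_one φ⟩
    have o := ode (cos φ)
    have sc := sin_sq_add_cos_sq φ
    interval_cases r
    · simp [Ar]
      have := (sq_le_one_iff_abs_le_one _).2 b1
      linarith
    · have e : Ar 1 q q1 q2 φ ^ 2 = (1 - cos φ ^ 2) * q1 (cos φ) ^ 2 := by
        simp [Ar]
        linear_combination (q1 (cos φ) ^ 2) * sc
      rw [e]
      nlinarith [sq_nonneg M]
    · have e : Ar 2 q q1 q2 φ = 2 * cos φ * q1 (cos φ) - M ^ 2 * q (cos φ) := by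
        simp only [Ar]
        norm_num
        linear_combination o + q2 (cos φ) * sc
      have : |Ar 2 q q1 q2 φ| ≤ 3 * M ^ 2 := by
        rw [e]
        refine (abs_sub _ _).trans ?_
        rw [abs_mul, abs_mul, abs_mul, abs_two, abs_of_nonneg hc0, abs_of_nonneg (sq_nonneg M)]
        have := mul_le_mul (cos_le_one φ) b3 (abs_nonneg _) zero_le_one
        have := mul_le_mul_of_nonneg_left b1 (sq_nonneg M)
        nlinarith
      have := pow_le_pow_left₀ (abs_nonneg _) this 2
      rw [sq_abs] at this
      linarith
  have hqc : Continuous q := continuous_iff_continuousAt.2 fun x => (h0 x).continuousAt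
  have hq1c : Continuous q1 := continuous_iff_continuousAt.2 fun x => (h1 x).continuousAt
  have hAc : ∀ r, Continuous (Ar r q q1 q2) := by
    intro r
    unfold Ar
    split_ifs <;> fun_prop
  have hFc : Continuous (fun φ => Ar r₁ q q1 q2 φ ^ 2 * Ar r₂ q q1 q2 φ ^ 2 * sin φ) :=
    (((hAc r₁).pow 2).mul ((hAc r₂).pow 2)).mul continuous_sin
  have hint1 : |∫ φ in (0 : ℝ)..δ, Ar r₁ q q1 q2 φ ^ 2 * Ar r₂ q q1 q2 φ ^ 2 * sin φ| ≤ Y * (324 * M ^ 2) := by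
    have := intervalIntegral.norm_integral_le_of_norm_le_const (a := 0) (b := δ)
      (f := fun φ => Ar r₁ q q1 q2 φ ^ 2 * Ar r₂ q q1 q2 φ ^ 2 * sin φ)
      (C := (9 * (M ^ 2) ^ r₁) * (9 * (M ^ 2) ^ r₂) * δ) (by
        intro φ hφ
        rw [Set.uIoc_of_le hδ0.le] at hφ
        have hφ' : φ ∈ Set.Icc 0 δ := ⟨hφ.1.le, hφ.2⟩
        have s0 : 0 ≤ sin φ := sin_nonneg_of_nonneg_of_le_pi hφ'.1 (by linarith [hφ'.2])
        have s1 : sin φ ≤ δ := (sin_le hφ'.1).trans hφ'.2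
        rw [Real.norm_eq_abs, abs_of_nonneg (by positivity)]
        have := hAb r₁ hr₁ φ hφ'
        have := hAb r₂ hr₂ φ hφ'
        gcongr)
    rw [Real.norm_eq_abs, sub_zero, abs_of_pos hδ0] at this
    refine this.trans ?_
    have e : 9 * (M ^ 2) ^ r₁ * (9 * (M ^ 2) ^ r₂) * δ * δ = Y * (81 / 4 * π ^ 2 * M ^ 2) := by
      rw [hY, hδ, pow_add]; field_simp; ring
    rw [e]
    refine mul_le_mul_of_nonneg_left ?_ hY0
    have : π ^ 2 ≤ 16 := by nlinarith [pi_le_four]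
    nlinarith [sq_nonneg M]
  rw [← intervalIntegral.integral_add_adjacent_intervals (hFc.intervalIntegrable 0 δ) (hFc.intervalIntegrable δ (π / 2)),
    hint2]
  set J := ∫ φ in δ..(π / 2), Tr r₁ (f φ) (g φ) M (sin φ) (cos φ) * Tr r₂ (f φ) (g φ) M (sin φ) (cos φ)
        * sin φ
  set I0 := ∫ φ in (0 : ℝ)..δ, Ar r₁ q q1 q2 φ ^ 2 * Ar r₂ q q1 q2 φ ^ 2 * sin φ
  set Λ := ∫ x in δ..(π / 2), 1 / sin x
  rw [show I0 + Y * J - Y * ((2 + (-1) ^ (r₁ + r₂)) / 8 * G0 ^ 2 * Λ) =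
    I0 + Y * (J - (2 + (-1) ^ (r₁ + r₂)) / 8 * G0 ^ 2 * Λ) by ring]
  refine (abs_add_le _ _).trans ?_
  rw [abs_mul, abs_of_nonneg hY0]
  have := mul_le_mul_of_nonneg_left hcore hY0
  linarith

lemma ratio_bound (n : ℝ) (hn : 1 ≤ n) (k : ℕ) (hk : k ≤ 4) :
    |(n * (n + 1)) ^ k / (n * (n + 1)) ^ 2 * n ^ 2 - n ^ (2 * k) / n ^ 2| ≤ 3 / n * (n ^ (2 * k) / n ^ 2) := by
  have hn0 : 0 < n := by linarith
  set t := 1 / n with ht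
  have ht0 : 0 < t := by positivity
  have ht1 : t ≤ 1 := by rw [ht, div_le_one hn0]; exact hn
  have e : n * (n + 1) = n ^ 2 * (1 + t) := by rw [ht]; field_simp
  have e2 : (n * (n + 1)) ^ k / (n * (n + 1)) ^ 2 * n ^ 2 - n ^ (2 * k) / n ^ 2
      = ((1 + t) ^ k / (1 + t) ^ 2 - 1) * (n ^ (2 * k) / n ^ 2) := by
    rw [e, mul_pow, ← pow_mul]
    field_simp
  have key : |(1 + t) ^ k / (1 + t) ^ 2 - 1| ≤ 3 * t := by
    have h1 : 0 < 1 + t := by linarith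
    rw [div_sub_one (by positivity), abs_div, abs_of_pos (pow_pos h1 2), div_le_iff₀ (by positivity), abs_le]
    interval_cases k <;> constructor <;>
      nlinarith [mul_pos ht0 ht0, mul_pos (mul_pos ht0 ht0) ht0, mul_nonneg ht0.le (sub_nonneg.2 ht1),
        mul_nonneg (mul_pos ht0 ht0).le (sub_nonneg.2 ht1)]
  rw [e2, abs_mul, abs_of_nonneg (by positivity : 0 ≤ n ^ (2 * k) / n ^ 2)]
  refine mul_le_mul_of_nonneg_right ?_ (by positivity)
  rw [show 3 / n = 3 * t by rw [ht]; ring]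
  exact key

set_option maxHeartbeats 1000000 in
lemma final_arith (n M G0 Λ I κ : ℝ) (k : ℕ) (hk : k ≤ 4) (hn : 1 ≤ n) (hM0 : 0 < M)
    (hM : M ^ 2 = n * (n + 1))
    (hG1 : 2 * n / π ≤ G0) (hG2 : G0 ≤ 2 * (n + 2) / π) (hΛ1 : log M ≤ Λ) (hΛ2 : Λ ≤ log M + 2)
    (hκ0 : 0 ≤ κ) (hκ1 : κ ≤ 1)
    (hI : |I - ((M ^ 2) ^ k / (M ^ 2) ^ 2) * (κ * G0 ^ 2 * Λ)|
      ≤ ((M ^ 2) ^ k / (M ^ 2) ^ 2) * (1871 * G0 ^ 2 + 324 * M ^ 2)) :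
    |I - κ * 4 / π ^ 2 * (n ^ (2 * k) / n ^ 2) * log n| ≤ 50000 * (n ^ (2 * k) / n ^ 2) := by
  have hn0 : 0 < n := by linarith
  have hp3 := pi_gt_three
  have hp : 0 < π := pi_pos
  have hlog0 : 0 ≤ log n := log_nonneg hn
  have hlogn : log n ≤ n := (log_le_sub_one_of_pos hn0).trans (by linarith)
  have hl1 : log n ≤ log M := log_le_log hn0 (by nlinarith)
  have hl2 : log M ≤ log n + 1 := by
    have : log M ≤ log (2 * n) := log_le_log hM0 (by nlinarith)
    rw [log_mul two_ne_zero hn0.ne'] at this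
    have := log_two_lt_d9
    linarith
  have hd : |Λ - log n| ≤ 3 := abs_le.2 ⟨by linarith, by linarith⟩
  -- G0
  set A := 4 * n ^ 2 / π ^ 2 with hA
  have hG00 : 0 ≤ G0 := le_trans (by positivity) hG1
  have g1 : A ≤ G0 ^ 2 := by
    have := pow_le_pow_left₀ (by positivity) hG1 2
    rw [hA]; refine le_trans (le_of_eq ?_) this; ring
  have g2 : G0 ^ 2 ≤ A + 4 * n := by
    have := pow_le_pow_left₀ hG00 hG2 2
    refine this.trans ?_
    rw [hA, div_pow, div_le_iff₀ (by positivity), add_mul, div_mul_cancel₀ _ (by positivity)]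
    have : (9 : ℝ) ≤ π ^ 2 := by nlinarith
    nlinarith [mul_le_mul_of_nonneg_left this hn0.le]
  have hA0 : 0 ≤ A := by positivity
  have hA1 : A ≤ n ^ 2 := by
    rw [hA, div_le_iff₀ (by positivity)]
    have : (9 : ℝ) ≤ π ^ 2 := by nlinarith
    nlinarith [sq_nonneg n]
  have hG3 : G0 ^ 2 ≤ 5 * n ^ 2 := by nlinarith
  have c1 : |κ * G0 ^ 2 * Λ - κ * A * log n| ≤ 19 * n ^ 2 := by
    rw [show κ * G0 ^ 2 * Λ - κ * A * log n = κ * (G0 ^ 2 * (Λ - log n) + (G0 ^ 2 - A) * log n) by ring,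
      abs_mul, abs_of_nonneg hκ0]
    have a1 : |G0 ^ 2 * (Λ - log n)| ≤ 5 * n ^ 2 * 3 := by
      rw [abs_mul, abs_of_nonneg (sq_nonneg G0)]
      gcongr
    have a2 : |(G0 ^ 2 - A) * log n| ≤ 4 * n * n := by
      rw [abs_mul, abs_of_nonneg hlog0, abs_of_nonneg (by linarith : 0 ≤ G0 ^ 2 - A)]
      have : G0 ^ 2 - A ≤ 4 * n := by linarith
      gcongr
    have a3 := (abs_add_le (G0 ^ 2 * (Λ - log n)) ((G0 ^ 2 - A) * log n)).trans (add_le_add a1 a2)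
    calc _ ≤ 1 * (5 * n ^ 2 * 3 + 4 * n * n) := by gcongr
      _ = _ := by ring
  have hrat := ratio_bound n hn k hk
  rw [← hM] at hrat
  set Y := (M ^ 2) ^ k / (M ^ 2) ^ 2 with hY
  set N := n ^ (2 * k) / n ^ 2 with hN
  have hY0 : 0 ≤ Y := by positivity
  have hN0 : 0 ≤ N := by positivity
  have hYN : Y * n ^ 2 ≤ 4 * N := by
    have := (abs_le.1 hrat).2
    have h3 : 3 / n ≤ 3 := div_le_self (by norm_num) hn
    nlinarith
  have hI2 : |I - Y * (κ * A * log n)| ≤ 9999 * (Y * n ^ 2) + 25 * (Y * n ^ 2) := by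
    have e : I - Y * (κ * A * log n) = (I - Y * (κ * G0 ^ 2 * Λ)) + Y * (κ * G0 ^ 2 * Λ - κ * A * log n) := by ring
    rw [e]
    refine (abs_add_le _ _).trans ?_
    rw [abs_mul, abs_of_nonneg hY0]
    have b1 := mul_le_mul_of_nonneg_left c1 hY0
    have b2 : 1871 * G0 ^ 2 + 324 * M ^ 2 ≤ 10003 * n ^ 2 := by rw [hM]; nlinarith
    have b3 := mul_le_mul_of_nonneg_left b2 hY0
    nlinarith
  have hlast : |Y * (κ * A * log n) - κ * 4 / π ^ 2 * N * log n| ≤ 3 * N := by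
    have e : Y * (κ * A * log n) - κ * 4 / π ^ 2 * N * log n = (κ * (4 / π ^ 2)) * (log n * (Y * n ^ 2 - N)) := by
      rw [hA]; ring
    rw [e, abs_mul, abs_mul (log n), abs_of_nonneg hlog0, abs_of_nonneg (by positivity : 0 ≤ κ * (4 / π ^ 2))]
    have h4 : 4 / π ^ 2 ≤ 1 := by
      rw [div_le_one (by positivity)]; nlinarith
    have h5 : κ * (4 / π ^ 2) ≤ 1 * 1 := mul_le_mul hκ1 h4 (by positivity) zero_le_one
    have h6 : log n * |Y * n ^ 2 - N| ≤ n * (3 / n * N) :=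
      mul_le_mul hlogn hrat (abs_nonneg _) hn0.le
    refine (mul_le_mul h5 h6 (mul_nonneg hlog0 (abs_nonneg _)) (by norm_num)).trans (le_of_eq ?_)
    rw [← mul_assoc n, mul_div_cancel₀ _ hn0.ne']; ring
  have e : I - κ * 4 / π ^ 2 * N * log n = (I - Y * (κ * A * log n)) + (Y * (κ * A * log n) - κ * 4 / π ^ 2 * N * log n) := by ring
  rw [e]
  refine (abs_add_le _ _).trans ?_
  nlinarith

/-- For `r₁, r₂ ∈ {0,1,2}`, as `ℓ → ∞`,
`∫₀^{π/2} [P_ℓ^{(r₁)}(cos φ) sin^{r₁} φ]² [P_ℓ^{(r₂)}(cos φ) sin^{r₂} φ]² sin φ dφ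
  = ((2+(−1)^{r₁+r₂})/(2π²))·ℓ^{2(r₁+r₂)−2}·log ℓ + O(ℓ^{2(r₁+r₂)−2})`. -/
theorem integral_mixed_fourth_power_legendre_asymp :
    ∀ r₁ ∈ ({0, 1, 2} : Set ℕ), ∀ r₂ ∈ ({0, 1, 2} : Set ℕ),
      ∃ C > (0 : ℝ), ∃ l₀ : ℕ, ∀ l : ℕ, l₀ ≤ l →
        |(∫ φ in (0 : ℝ)..(π / 2),
            (iteratedDeriv r₁ (legendreP l) (Real.cos φ) * Real.sin φ ^ r₁) ^ 2
              * (iteratedDeriv r₂ (legendreP l) (Real.cos φ) * Real.sin φ ^ r₂) ^ 2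
              * Real.sin φ)
          - (2 + (-1 : ℝ) ^ (r₁ + r₂)) / (2 * π ^ 2)
              * ((l : ℝ) ^ (2 * (r₁ + r₂)) / (l : ℝ) ^ 2) * Real.log l|
        ≤ C * ((l : ℝ) ^ (2 * (r₁ + r₂)) / (l : ℝ) ^ 2) := by
  intro r₁ hr₁ r₂ hr₂
  have hr₁' : r₁ ≤ 2 := by
    simp only [Set.mem_insert_iff, Set.mem_singleton_iff] at hr₁
    omega
  have hr₂' : r₂ ≤ 2 := by
    simp only [Set.mem_insert_iff, Set.mem_singleton_iff] at hr₂
    omega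
  refine ⟨50000, by norm_num, 1, ?_⟩
  intro l hl
  have hn : (1 : ℝ) ≤ l := by exact_mod_cast hl
  set M := √((l : ℝ) * (l + 1)) with hMdef
  have hM2 : M ^ 2 = (l : ℝ) * (l + 1) := sq_sqrt (by positivity)
  have hM0 : 0 < M := sqrt_pos.2 (by positivity)
  have hM1 : 1 ≤ M := by nlinarith
  let p := legQ l
  let q : ℝ → ℝ := fun x => p.eval x
  let q1 : ℝ → ℝ := fun x => (Polynomial.derivative^[1] p).eval x
  let q2 : ℝ → ℝ := fun x => (Polynomial.derivative^[2] p).eval x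
  have hA : ∀ r ≤ 2, ∀ φ, iteratedDeriv r (legendreP l) (Real.cos φ) * Real.sin φ ^ r = Ar r q q1 q2 φ := by
    intro r hr φ
    rw [legQ_eval, aux_iter]
    interval_cases r <;> simp [Ar, q, q1, q2, p]
  obtain ⟨Λ, hΛ1, hΛ2, hI⟩ := total_int q q1 q2 M hM1 (fun x => p.hasDerivAt x)
    (fun x => (Polynomial.derivative p).hasDerivAt x) (Polynomial.continuous _)
    (fun x => by rw [hM2]; exact legQ_ode l x) (legQ_one l) r₁ r₂ hr₁' hr₂'
  obtain ⟨e1, e2⟩ := legQ_energy l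
  rw [← hM2] at e1 e2
  simp only [hA r₁ hr₁', hA r₂ hr₂']
  have hκ : 0 ≤ (2 + (-1 : ℝ) ^ (r₁ + r₂)) / 8 ∧ (2 + (-1 : ℝ) ^ (r₁ + r₂)) / 8 ≤ 1 := by
    rcases neg_one_pow_eq_or ℝ (r₁ + r₂) with h | h <;> rw [h] <;> norm_num
  have := final_arith l M (q1 0 ^ 2 + M ^ 2 * q 0 ^ 2) Λ _ ((2 + (-1 : ℝ) ^ (r₁ + r₂)) / 8) (r₁ + r₂)
    (by omega) hn hM0 hM2 e1 e2 hΛ1 hΛ2 hκ.1 hκ.2 hI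
  rw [show (2 + (-1 : ℝ) ^ (r₁ + r₂)) / (2 * π ^ 2) = (2 + (-1 : ℝ) ^ (r₁ + r₂)) / 8 * 4 / π ^ 2 by
    field_simp; ring]
  exact this
end

section
/- For each k ∈ {1, 2, 3, 4}, as ℓ → ∞ over positive integers, ∫₀^{π/2} |P_ℓ'(cos φ)|^k · |P_ℓ''(cos φ)·sin² φ|^{4−k} · sin φ dφ = O(ℓ⁶), i.e. there is a constant C > 0 such that the integral is at most C·ℓ⁶ for all large ℓ. -/
open Real

open Polynomial in
/-- Legendre polynomial as a polynomial. -/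
noncomputable def legPoly (l : ℕ) : ℝ[X] :=
  C (1 / (2 ^ l * (Nat.factorial l : ℝ))) * derivative^[l] ((X ^ 2 - 1) ^ l)

open Polynomial in
theorem iteratedDeriv_polyEval (p : ℝ[X]) (n : ℕ) :
    iteratedDeriv n (fun x => p.eval x) = fun x => (derivative^[n] p).eval x := by
  induction n with
  | zero => simp
  | succ n ih =>
    rw [iteratedDeriv_succ, ih, Function.iterate_succ_apply']
    funext x
    exact Polynomial.deriv _

open Polynomial in
theorem legendreP_eq (l : ℕ) : legendreP l = fun x => (legPoly l).eval x := by
  funext x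
  have h : (fun y : ℝ => (y ^ 2 - 1) ^ l) = fun y => ((X ^ 2 - 1 : ℝ[X]) ^ l).eval y := by
    funext y; simp
  unfold legendreP legPoly
  rw [h, iteratedDeriv_polyEval]
  simp

open Polynomial in
theorem rodrigues_aux (l k : ℕ) :
    (X ^ 2 - 1) * derivative^[k + 2] ((X ^ 2 - 1 : ℝ[X]) ^ l)
      + 2 * ((k : ℝ[X]) + 1) * X * derivative^[k + 1] ((X ^ 2 - 1 : ℝ[X]) ^ l)
      + (k : ℝ[X]) * ((k : ℝ[X]) + 1) * derivative^[k] ((X ^ 2 - 1 : ℝ[X]) ^ l)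
    = 2 * (l : ℝ[X]) * X * derivative^[k + 1] ((X ^ 2 - 1 : ℝ[X]) ^ l)
      + 2 * (l : ℝ[X]) * ((k : ℝ[X]) + 1) * derivative^[k] ((X ^ 2 - 1 : ℝ[X]) ^ l) := by
  induction k with
  | zero =>
    have h0 : (X ^ 2 - 1) * derivative ((X ^ 2 - 1 : ℝ[X]) ^ l)
        = 2 * (l : ℝ[X]) * X * (X ^ 2 - 1 : ℝ[X]) ^ l := by
      cases l with
      | zero => simp
      | succ m =>
        rw [derivative_pow_succ]
        simp only [derivative_sub, derivative_X_pow, derivative_one, map_add, map_natCast, map_one]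
        push_cast
        simp
        ring
    have h1 := congrArg derivative h0
    simp only [derivative_mul, derivative_sub, derivative_X_pow, derivative_one, derivative_X,
      derivative_natCast, derivative_ofNat] at h1
    simp only [Function.iterate_succ_apply', Function.iterate_zero, id]
    simp at h1 ⊢
    have hC : (C 2 : ℝ[X]) = 2 := rfl
    try rw [hC] at h1
    linear_combination h1
  | succ k ih =>
    have h1 := congrArg derivative ih
    simp only [Function.iterate_succ_apply'] at h1 ⊢
    simp only [derivative_mul, derivative_sub, derivative_add, derivative_X_pow, derivative_one,
      derivative_X, derivative_natCast, derivative_ofNat] at h1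
    simp at h1 ⊢
    have hC : (C 2 : ℝ[X]) = 2 := rfl
    try rw [hC] at h1
    linear_combination h1

open Polynomial in
theorem legPoly_ode (l : ℕ) :
    (1 - X ^ 2) * derivative (derivative (legPoly l)) - 2 * X * derivative (legPoly l)
      + (l : ℝ[X]) * ((l : ℝ[X]) + 1) * legPoly l = 0 := by
  have h := rodrigues_aux l l
  unfold legPoly
  simp only [Function.iterate_succ_apply', derivative_C_mul] at h ⊢
  linear_combination (-C (1 / (2 ^ l * (Nat.factorial l : ℝ)))) * h

open Polynomial in
theorem legPoly_one (l : ℕ) : (legPoly l).eval 1 = 1 := by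
  unfold legPoly
  rw [← factorial_smul_hasseDeriv]
  simp only [LinearMap.smul_apply, eval_mul, eval_C, eval_smul]
  rw [← taylor_coeff, taylor_pow]
  have : taylor (1 : ℝ) (X ^ 2 - 1) = X * (X + C 2) := by
    simp only [map_sub, taylor_X_pow, taylor_one]
    have : (C 2 : ℝ[X]) = 2 := rfl
    rw [this]; simp; ring
  rw [this, mul_pow, mul_comm (X ^ l)]
  have h2 : ((X + C (2 : ℝ)) ^ l * X ^ l).coeff l = 2 ^ l := by
    have := coeff_mul_X_pow ((X + C (2 : ℝ)) ^ l) l 0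
    rw [zero_add] at this
    rw [this, coeff_zero_eq_eval_zero]; simp
  rw [h2]
  have := Nat.factorial_pos l
  simp
  field_simp

theorem centralBinom_sq_le (n : ℕ) : Nat.centralBinom n ^ 2 * (2 * n + 1) ≤ 16 ^ n := by
  induction n with
  | zero => simp
  | succ n ih =>
    have h := Nat.succ_mul_centralBinom_succ n
    have h2 : (n + 1) ^ 2 * (Nat.centralBinom (n + 1) ^ 2 * (2 * (n + 1) + 1))
        ≤ (n + 1) ^ 2 * 16 ^ (n + 1) := by
      calc (n + 1) ^ 2 * (Nat.centralBinom (n + 1) ^ 2 * (2 * (n + 1) + 1))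
          = ((n + 1) * Nat.centralBinom (n + 1)) ^ 2 * (2 * n + 3) := by ring
        _ = (Nat.centralBinom n ^ 2 * (2 * n + 1)) * (4 * (2 * n + 1) * (2 * n + 3)) := by
            rw [h]; ring
        _ ≤ 16 ^ n * (16 * (n + 1) ^ 2) := by
            apply Nat.mul_le_mul ih
            nlinarith
        _ = _ := by ring
    exact Nat.le_of_mul_le_mul_left h2 (by positivity)

theorem choose_sq_le (l j : ℕ) : (l.choose j) ^ 2 * (l + 1) ≤ 2 * 4 ^ l := by
  have h1 : (l.choose j) ^ 2 * (l + 1) ≤ (l.choose (l / 2)) ^ 2 * (l + 1) := by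
    gcongr
    exact Nat.choose_le_middle j l
  refine h1.trans ?_
  rcases Nat.even_or_odd' l with ⟨m, rfl | rfl⟩
  · have := centralBinom_sq_le m
    rw [Nat.centralBinom] at this
    rw [Nat.mul_div_cancel_left _ (by norm_num : 0 < 2), pow_mul]
    norm_num
    omega
  · have := centralBinom_sq_le m
    have h3 : (2 * m + 1).choose ((2 * m + 1) / 2) ≤ 2 * Nat.centralBinom m := by
      have : (2 * m + 1) / 2 = m := by omega
      rw [this]
      cases m with
      | zero => simp
      | succ k =>
        rw [Nat.choose_succ_succ, Nat.succ_eq_add_one]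
        have a := Nat.choose_le_centralBinom k (k + 1)
        have b := Nat.choose_le_centralBinom (k + 1) (k + 1)
        omega
    have h4 : (4 : ℕ) ^ (2 * m + 1) = 4 * 16 ^ m := by
      rw [pow_succ, pow_mul]; norm_num; ring
    rw [h4]
    calc _ ≤ (2 * Nat.centralBinom m) ^ 2 * (2 * m + 1 + 1) := by gcongr
      _ ≤ 8 * (Nat.centralBinom m ^ 2 * (2 * m + 1)) := by nlinarith [sq_nonneg (Nat.centralBinom m)]
      _ ≤ _ := by omega

open Polynomial in
theorem coeff_sq_le (l j : ℕ) :
    (((X ^ 2 - 1 : ℝ[X]) ^ l).coeff j) ^ 2 * (l + 1) ≤ 2 * 4 ^ l := by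
  have h : (X ^ 2 - 1 : ℝ[X]) ^ l = expand ℝ 2 ((X + C (-1)) ^ l) := by
    simp [sub_eq_add_neg]
  rw [h, coeff_expand (by norm_num)]
  split_ifs
  · rw [coeff_X_add_C_pow]
    have h3 : ((l.choose (j / 2) : ℝ)) ^ 2 * (l + 1) ≤ 2 * 4 ^ l := by
      exact_mod_cast choose_sq_le l (j / 2)
    rw [mul_pow, ← pow_mul, mul_comm _ 2, pow_mul]
    simpa using h3
  · simp

open Polynomial in
theorem legPoly_zero_sq (l : ℕ) : ((legPoly l).eval 0) ^ 2 * (l + 1) ≤ 2 := by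
  have h := coeff_sq_le l l
  have e : (legPoly l).eval 0 = ((X ^ 2 - 1 : ℝ[X]) ^ l).coeff l / 2 ^ l := by
    unfold legPoly
    rw [eval_mul, eval_C, ← coeff_zero_eq_eval_zero, coeff_iterate_derivative]
    have := Nat.factorial_pos l
    simp [Nat.descFactorial_self]
    field_simp
  rw [e, div_pow, ← pow_mul, mul_comm l 2, pow_mul, div_mul_eq_mul_div]
  rw [div_le_iff₀ (by positivity)]
  norm_num
  exact h

open Polynomial in
theorem legPoly_deriv_zero_sq (l : ℕ) :
    ((derivative (legPoly l)).eval 0) ^ 2 ≤ 2 * (l + 1) := by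
  have h := coeff_sq_le l (l + 1)
  have e : (derivative (legPoly l)).eval 0
      = (l + 1) * ((X ^ 2 - 1 : ℝ[X]) ^ l).coeff (l + 1) / 2 ^ l := by
    unfold legPoly
    rw [derivative_C_mul, ← Function.iterate_succ_apply' (derivative : ℝ[X] → ℝ[X]),
      eval_mul, eval_C, ← coeff_zero_eq_eval_zero, coeff_iterate_derivative]
    have := Nat.factorial_pos l
    rw [zero_add, Nat.succ_eq_add_one, Nat.descFactorial_self, Nat.factorial_succ]
    simp only [nsmul_eq_mul]
    push_cast
    field_simp
  rw [e, div_pow, ← pow_mul, mul_comm l 2, pow_mul]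
  rw [div_le_iff₀ (by positivity)]
  norm_num
  have : (0 : ℝ) ≤ l + 1 := by positivity
  nlinarith [mul_le_mul_of_nonneg_left h this]

/-- First Sonin function: increasing. -/
theorem sonin_mono {f f1 f2 : ℝ → ℝ} (h0 : ∀ x, HasDerivAt f (f1 x) x)
    (h1 : ∀ x, HasDerivAt f1 (f2 x) x) {c N : ℝ} (hc : 1 ≤ c) (hN : 0 < N)
    (ode : ∀ x, (1 - x ^ 2) * f2 x - 2 * c * x * f1 x + N * f x = 0)
    {x : ℝ} (hx0 : 0 ≤ x) (hx1 : x ≤ 1) : f x ^ 2 ≤ f 1 ^ 2 := by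
  have hd : ∀ x, HasDerivAt (fun x => f x ^ 2 + (1 - x ^ 2) * f1 x ^ 2 / N)
      ((4 * c - 2) * x * f1 x ^ 2 / N) x := by
    intro x
    have := ((h0 x).pow 2).add
      (((((hasDerivAt_id x).pow 2).const_sub 1).mul ((h1 x).pow 2)).div_const N)
    refine this.congr_deriv ?_
    simp
    field_simp
    linear_combination 2 * f1 x * ode x
  have hm : MonotoneOn (fun x => f x ^ 2 + (1 - x ^ 2) * f1 x ^ 2 / N) (Set.Icc 0 1) := by
    refine monotoneOn_of_hasDerivWithinAt_nonneg (convex_Icc 0 1)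
      (fun x _ => (hd x).continuousAt.continuousWithinAt)
      (fun x _ => (hd x).hasDerivWithinAt) ?_
    intro x hx
    rw [interior_Icc] at hx
    have := hx.1
    have : 0 ≤ 4 * c - 2 := by linarith
    positivity
  have := hm ⟨hx0, hx1⟩ ⟨zero_le_one, le_refl _⟩ hx1
  simp only at this
  have h3 : 0 ≤ (1 - x ^ 2) * f1 x ^ 2 / N := by
    have : 0 ≤ 1 - x ^ 2 := by nlinarith
    positivity
  simp at this
  linarith

/-- Second Sonin function: decreasing. -/
theorem sonin_anti {f f1 f2 : ℝ → ℝ} (h0 : ∀ x, HasDerivAt f (f1 x) x)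
    (h1 : ∀ x, HasDerivAt f1 (f2 x) x) {N : ℝ} (hN : 0 ≤ N)
    (ode : ∀ x, (1 - x ^ 2) * f2 x - 2 * x * f1 x + N * f x = 0)
    {x : ℝ} (hx0 : 0 ≤ x) (hx1 : x ≤ 1) :
    (1 - x ^ 2) * (f x ^ 2 + (x * f x - 2 * (1 - x ^ 2) * f1 x) ^ 2
      / ((4 * N + 1) * (1 - x ^ 2) + 1)) ^ 2
      ≤ (f 0 ^ 2 + 4 * f1 0 ^ 2 / (4 * N + 2)) ^ 2 := by
  set W : ℝ → ℝ := fun x => x * f x - 2 * (1 - x ^ 2) * f1 x with hW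
  set Q : ℝ → ℝ := fun x => (4 * N + 1) * (1 - x ^ 2) + 1 with hQ
  have hQpos : ∀ x ∈ Set.Icc (0 : ℝ) 1, 0 < Q x := by
    intro x hx
    have : 0 ≤ 1 - x ^ 2 := by nlinarith [hx.1, hx.2]
    simp only [hQ]; positivity
  have hWd : ∀ x, HasDerivAt W ((1 + 2 * N) * f x + x * f1 x) x := by
    intro x
    have := ((hasDerivAt_id x).mul (h0 x)).sub
      (((((hasDerivAt_id x).pow 2).const_sub 1).const_mul 2).mul (h1 x))
    refine this.congr_deriv ?_
    simp
    linear_combination (-2) * ode x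
  have hQd : ∀ x, HasDerivAt Q (-2 * (4 * N + 1) * x) x := by
    intro x
    have := ((((hasDerivAt_id x).pow 2).const_sub 1).const_mul (4 * N + 1)).add_const 1
    refine this.congr_deriv ?_
    simp
    ring
  have hd : ∀ x ∈ Set.Icc (0 : ℝ) 1,
      HasDerivAt (fun x => (1 - x ^ 2) * (f x ^ 2 + W x ^ 2 / Q x) ^ 2)
      (2 * (f x ^ 2 + W x ^ 2 / Q x) * (-2 * x * W x ^ 2 / Q x ^ 2)) x := by
    intro x hx
    have hq := (hQpos x hx).ne'
    have := ((((hasDerivAt_id x).pow 2).const_sub 1)).mul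
      ((((h0 x).pow 2).add (((hWd x).pow 2).div (hQd x) hq)).pow 2)
    refine this.congr_deriv ?_
    have key : (1 - x ^ 2) * (2 * f x * f1 x
        + (2 * W x * ((1 + 2 * N) * f x + x * f1 x) * Q x - W x ^ 2 * (-2 * (4 * N + 1) * x))
          / Q x ^ 2) - x * (f x ^ 2 + W x ^ 2 / Q x) = -2 * x * W x ^ 2 / Q x ^ 2 := by
      field_simp
      simp only [hW, hQ]
      ring
    rw [← key]
    simp
    ring
  have hm : AntitoneOn (fun x => (1 - x ^ 2) * (f x ^ 2 + W x ^ 2 / Q x) ^ 2) (Set.Icc 0 1) := by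
    refine antitoneOn_of_hasDerivWithinAt_nonpos (convex_Icc 0 1)
      (fun x hx => (hd x hx).continuousAt.continuousWithinAt)
      (fun x hx => (hd x (interior_subset hx)).hasDerivWithinAt) ?_
    intro x hx
    have h4 := hQpos x (interior_subset hx)
    rw [interior_Icc] at hx
    have := hx.1
    have h5 : 0 ≤ 2 * (f x ^ 2 + W x ^ 2 / Q x) * (2 * x * W x ^ 2 / Q x ^ 2) := by positivity
    have h6 : 2 * (f x ^ 2 + W x ^ 2 / Q x) * (-2 * x * W x ^ 2 / Q x ^ 2)
      = -(2 * (f x ^ 2 + W x ^ 2 / Q x) * (2 * x * W x ^ 2 / Q x ^ 2)) := by ring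
    rw [h6]; linarith
  have := hm ⟨le_refl _, zero_le_one⟩ ⟨hx0, hx1⟩ hx0
  simp only at this
  refine this.trans (le_of_eq ?_)
  simp only [hW, hQ]
  ring

set_option maxHeartbeats 1000000 in
open Polynomial in
theorem pointwise_bound (l : ℕ) (hl : 2 ≤ l) (x s r : ℝ) (hx0 : 0 ≤ x) (hx1 : x ≤ 1)
    (hs0 : 0 ≤ s) (hs : s ^ 2 = 1 - x ^ 2) (hr : 1 ≤ r) (hr2 : r ^ 2 = max 1 (l * s)) :
    |(derivative (legPoly l)).eval x| * r ^ 3 ≤ 22 * (l : ℝ) ^ 2 ∧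
    |(derivative (derivative (legPoly l))).eval x * s ^ 2| * r ≤ 22 * (l : ℝ) ^ 2 := by
  have hL : (2 : ℝ) ≤ l := by exact_mod_cast hl
  set L : ℝ := (l : ℝ) with hLdef
  set p := legPoly l with hp
  set f : ℝ → ℝ := fun x => p.eval x with hf
  set f1 : ℝ → ℝ := fun x => (derivative p).eval x with hf1
  set f2 : ℝ → ℝ := fun x => (derivative (derivative p)).eval x with hf2
  set f3 : ℝ → ℝ := fun x => (derivative (derivative (derivative p))).eval x with hf3
  have d0 : ∀ x, HasDerivAt f (f1 x) x := fun x => p.hasDerivAt x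
  have d1 : ∀ x, HasDerivAt f1 (f2 x) x := fun x => (derivative p).hasDerivAt x
  have d2 : ∀ x, HasDerivAt f2 (f3 x) x := fun x => (derivative (derivative p)).hasDerivAt x
  have ode : ∀ x, (1 - x ^ 2) * f2 x - 2 * x * f1 x + L * (L + 1) * f x = 0 := by
    intro x
    have := congrArg (fun q => eval x q) (legPoly_ode l)
    simpa using this
  have ode' : ∀ x, (1 - x ^ 2) * f3 x - 2 * 2 * x * f2 x + (L * (L + 1) - 2) * f1 x = 0 := by
    intro x
    have e := congrArg (fun q => eval x (derivative q)) (legPoly_ode l)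
    have hC : (C 2 : ℝ[X]) = 2 := rfl
    simp [derivative_mul, hC] at e
    simp only [hf1, hf2, hf3, hp, hLdef]
    linear_combination e
  have f_one : f 1 = 1 := legPoly_one l
  have f1_one : f1 1 = L * (L + 1) / 2 := by
    have := ode 1
    rw [f_one] at this
    linarith
  have bf : |f x| ≤ 1 := by
    have := sonin_mono d0 d1 (c := 1) (N := L * (L + 1)) le_rfl (by positivity)
      (by intro x; have := ode x; linarith) hx0 hx1
    rw [f_one] at this
    exact abs_le_of_sq_le_sq this zero_le_one
  have bf1 : |f1 x| ≤ L ^ 2 := by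
    have := sonin_mono d1 d2 (c := 2) (N := L * (L + 1) - 2) (by norm_num) (by nlinarith)
      ode' hx0 hx1
    rw [f1_one] at this
    have h2 := abs_le_of_sq_le_sq this (by positivity)
    nlinarith
  have bB : |f2 x * s ^ 2| ≤ 2 * |f1 x| + 2 * L ^ 2 * |f x| := by
    have h1 : f2 x * s ^ 2 = 2 * x * f1 x - L * (L + 1) * f x := by
      rw [hs]; linear_combination ode x
    rw [h1]
    refine (abs_sub _ _).trans ?_
    rw [abs_mul (2 * x), abs_mul (L * (L + 1)), abs_of_nonneg (by positivity : 0 ≤ 2 * x),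
      abs_of_nonneg (by positivity : 0 ≤ L * (L + 1))]
    have := abs_nonneg (f1 x)
    have := abs_nonneg (f x)
    have : L * (L + 1) ≤ 2 * L ^ 2 := by nlinarith
    gcongr
    linarith
  change |f1 x| * r ^ 3 ≤ 22 * L ^ 2 ∧ |f2 x * s ^ 2| * r ≤ 22 * L ^ 2
  rcases le_total (L * s) 1 with hcase | hcase
  · rw [max_eq_left hcase] at hr2
    have : r = 1 := by nlinarith
    rw [this]
    constructor
    · nlinarith
    · nlinarith [abs_nonneg (f x), abs_nonneg (f1 x), sq_nonneg L]
  · rw [max_eq_right hcase] at hr2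
    have hanti := sonin_anti d0 d1 (N := L * (L + 1)) (by positivity) ode hx0 hx1
    have g0 : f 0 ^ 2 + 4 * f1 0 ^ 2 / (4 * (L * (L + 1)) + 2) ≤ 10 / L := by
      have a : f 0 ^ 2 * (L + 1) ≤ 2 := legPoly_zero_sq l
      have b : f1 0 ^ 2 ≤ 2 * (L + 1) := legPoly_deriv_zero_sq l
      have a' : f 0 ^ 2 ≤ 2 / L := by
        rw [le_div_iff₀ (by positivity)]; nlinarith [sq_nonneg (f 0)]
      have b' : 4 * f1 0 ^ 2 / (4 * (L * (L + 1)) + 2) ≤ 8 / L := by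
        rw [div_le_div_iff₀ (by positivity) (by positivity)]
        nlinarith
      have : 10 / L = 2 / L + 8 / L := by ring
      linarith
    set W := x * f x - 2 * (1 - x ^ 2) * f1 x with hW
    set Q := (4 * (L * (L + 1)) + 1) * (1 - x ^ 2) + 1 with hQ
    have hQpos : 0 < Q := by
      rw [hQ, ← hs]; positivity
    set G := f x ^ 2 + W ^ 2 / Q with hG
    have hG0 : 0 ≤ G := by positivity
    have hsG : s * G ≤ 10 / L := by
      have h1 : (s * G) ^ 2 ≤ (10 / L) ^ 2 := by
        rw [mul_pow, hs]
        refine hanti.trans ?_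
        have : 0 ≤ f 0 ^ 2 + 4 * f1 0 ^ 2 / (4 * (L * (L + 1)) + 2) := by positivity
        gcongr
      exact le_of_abs_le (abs_le_of_sq_le_sq h1 (by positivity))
    have hGr : r ^ 2 * G ≤ 10 := by
      rw [le_div_iff₀ (by positivity)] at hsG
      rw [hr2]; linarith
    have hfr : |f x| * r ≤ 4 := by
      have h1 : (|f x| * r) ^ 2 ≤ 4 ^ 2 := by
        rw [mul_pow, sq_abs]
        have : f x ^ 2 ≤ G := by
          have : 0 ≤ W ^ 2 / Q := by positivity
          linarith
        nlinarith [sq_nonneg r]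
      exact le_of_abs_le (abs_le_of_sq_le_sq h1 (by positivity))
    have hr4 : L ^ 2 * s ^ 2 = r ^ 4 := by
      have : r ^ 4 = (r ^ 2) ^ 2 := by ring
      rw [this, hr2]; ring
    have hQr : Q ≤ 10 * r ^ 4 := by
      have h1 : 1 ≤ r ^ 4 := one_le_pow₀ hr
      rw [hQ, ← hs]
      have : (4 * (L * (L + 1)) + 1) * s ^ 2 ≤ 9 * L ^ 2 * s ^ 2 := by
        have : 4 * (L * (L + 1)) + 1 ≤ 9 * L ^ 2 := by nlinarith only [hL]
        gcongr
      linarith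
    have hWr : |W| ≤ 10 * r := by
      have h1 : (W) ^ 2 ≤ (10 * r) ^ 2 := by
        have h2 : W ^ 2 ≤ Q * G := by
          have : W ^ 2 / Q ≤ G := by
            have := sq_nonneg (f x)
            linarith
          rw [div_le_iff₀ hQpos] at this
          linarith
        calc W ^ 2 ≤ Q * G := h2
          _ ≤ 10 * r ^ 4 * G := by gcongr
          _ = 10 * r ^ 2 * (r ^ 2 * G) := by ring
          _ ≤ 10 * r ^ 2 * 10 := by gcongr
          _ = _ := by ring
      exact abs_le_of_sq_le_sq h1 (by positivity)
    have hA1 : s ^ 2 * |f1 x| ≤ 7 * r := by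
      have h1 : 2 * (s ^ 2 * f1 x) = x * f x - W := by rw [hW, hs]; ring
      have h2 : 2 * (s ^ 2 * |f1 x|) = |x * f x - W| := by
        rw [← h1, abs_mul, abs_mul, abs_of_nonneg (sq_nonneg s)]; norm_num
      have h3 : |x * f x - W| ≤ |x * f x| + |W| := abs_sub _ _
      rw [abs_mul, abs_of_nonneg hx0] at h3
      nlinarith [abs_nonneg (f x)]
    have hA : |f1 x| * r ^ 3 ≤ 7 * L ^ 2 := by
      have h1 : (|f1 x| * r ^ 3) * r ≤ (7 * L ^ 2) * r := by
        calc (|f1 x| * r ^ 3) * r = |f1 x| * r ^ 4 := by ring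
          _ = L ^ 2 * (s ^ 2 * |f1 x|) := by rw [← hr4]; ring
          _ ≤ L ^ 2 * (7 * r) := by gcongr
          _ = _ := by ring
      exact le_of_mul_le_mul_right h1 (by linarith)
    have hA' : |f1 x| * r ≤ 7 * L ^ 2 := by
      refine le_trans ?_ hA
      gcongr
      exact le_self_pow₀ hr (by norm_num)
    constructor
    · nlinarith [sq_nonneg L]
    · calc |f2 x * s ^ 2| * r ≤ (2 * |f1 x| + 2 * L ^ 2 * |f x|) * r := by gcongr
        _ = 2 * (|f1 x| * r) + 2 * L ^ 2 * (|f x| * r) := by ring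
        _ ≤ 2 * (7 * L ^ 2) + 2 * L ^ 2 * 4 := by gcongr
        _ = _ := by ring

theorem combine_bound (k : ℕ) (hk1 : 1 ≤ k) (hk4 : k ≤ 4) (A B r D : ℝ) (hA0 : 0 ≤ A)
    (hB0 : 0 ≤ B) (hr : 1 ≤ r) (hA : A * r ^ 3 ≤ D) (hB : B * r ≤ D) :
    A ^ k * B ^ (4 - k) * r ^ 6 ≤ D ^ 4 := by
  have hD : 0 ≤ D := le_trans (by positivity) hB
  calc A ^ k * B ^ (4 - k) * r ^ 6 ≤ A ^ k * B ^ (4 - k) * r ^ (3 * k + (4 - k)) := by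
        gcongr
        omega
    _ = (A * r ^ 3) ^ k * (B * r) ^ (4 - k) := by
        rw [mul_pow, mul_pow, pow_add, pow_mul]; ring
    _ ≤ D ^ k * D ^ (4 - k) := by gcongr
    _ = D ^ 4 := by rw [← pow_add]; congr 1; omega

theorem integrand_bound (k : ℕ) (hk1 : 1 ≤ k) (hk4 : k ≤ 4) (l : ℕ) (hl : 2 ≤ l) (φ : ℝ)
    (h0 : 0 ≤ φ) (h1 : φ ≤ π / 2) :
    |(Polynomial.derivative (legPoly l)).eval (Real.cos φ)| ^ k
      * |(Polynomial.derivative (Polynomial.derivative (legPoly l))).eval (Real.cos φ)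
          * Real.sin φ ^ 2| ^ (4 - k) * Real.sin φ
      ≤ 4 * 22 ^ 4 * (l : ℝ) ^ 7 * (1 + ((l : ℝ) * φ) ^ 2)⁻¹ := by
  have hL : (2 : ℝ) ≤ l := by exact_mod_cast hl
  have hsin0 : 0 ≤ Real.sin φ := Real.sin_nonneg_of_nonneg_of_le_pi h0 (by linarith [Real.pi_pos])
  have hcos0 : 0 ≤ Real.cos φ := Real.cos_nonneg_of_mem_Icc ⟨by linarith [Real.pi_pos], h1⟩
  set s := Real.sin φ with hsdef
  set r := Real.sqrt (max 1 (l * s)) with hrdef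
  have hr : 1 ≤ r := Real.one_le_sqrt.mpr (le_max_left _ _)
  have hr2 : r ^ 2 = max 1 (l * s) := Real.sq_sqrt (le_trans zero_le_one (le_max_left _ _))
  obtain ⟨hA, hB⟩ := pointwise_bound l hl (Real.cos φ) s r hcos0 (Real.cos_le_one φ) hsin0
    (by rw [hsdef, Real.sin_sq]) hr hr2
  have hc := combine_bound k hk1 hk4 _ _ r _ (abs_nonneg _) (abs_nonneg _) hr hA hB
  set T := |(Polynomial.derivative (legPoly l)).eval (Real.cos φ)| ^ k
      * |(Polynomial.derivative (Polynomial.derivative (legPoly l))).eval (Real.cos φ)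
          * s ^ 2| ^ (4 - k) with hT
  have hT0 : 0 ≤ T := by positivity
  have hphi : φ ≤ 1.6 * s := by
    have := Real.mul_le_sin h0 h1
    have hpi : π ≤ 3.2 := by linarith [Real.pi_lt_d2]
    have h3 : 2 * φ ≤ s * π := by
      rw [div_mul_eq_mul_div, div_le_iff₀ Real.pi_pos] at this
      exact this
    nlinarith
  have hls : (l : ℝ) * s ≤ r ^ 2 := hr2 ▸ le_max_right _ _
  have hr4 : 1 ≤ r ^ 4 := one_le_pow₀ hr
  have h4 : 1 + ((l : ℝ) * φ) ^ 2 ≤ 4 * r ^ 4 := by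
    have : (l : ℝ) * φ ≤ 1.6 * r ^ 2 := by nlinarith
    have h5 : ((l : ℝ) * φ) ^ 2 ≤ (1.6 * r ^ 2) ^ 2 := by
      gcongr
    nlinarith
  rw [← div_eq_mul_inv, le_div_iff₀ (by positivity)]
  have h6 : (l : ℝ) * (T * s * (1 + ((l : ℝ) * φ) ^ 2))
      ≤ l * (4 * 22 ^ 4 * (l : ℝ) ^ 7) := by
    calc (l : ℝ) * (T * s * (1 + ((l : ℝ) * φ) ^ 2))
        = T * (l * s) * (1 + ((l : ℝ) * φ) ^ 2) := by ring
      _ ≤ T * r ^ 2 * (4 * r ^ 4) := by gcongr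
      _ = 4 * (T * r ^ 6) := by ring
      _ ≤ 4 * (22 * (l : ℝ) ^ 2) ^ 4 := by gcongr
      _ = _ := by ring
  exact le_of_mul_le_mul_left h6 (by linarith)

/-- For `k ∈ {1,2,3,4}`, as `ℓ → ∞`,
`∫₀^{π/2} |P_ℓ'(cos φ)|^k |P_ℓ''(cos φ) sin²φ|^{4−k} sin φ dφ = O(ℓ⁶)`. -/
theorem integral_abs_mixed_legendre_bigO :
    ∀ k ∈ ({1, 2, 3, 4} : Set ℕ), ∃ C > (0 : ℝ), ∃ l₀ : ℕ, ∀ l : ℕ, l₀ ≤ l →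
      (∫ φ in (0 : ℝ)..(π / 2),
          |deriv (legendreP l) (Real.cos φ)| ^ k
            * |iteratedDeriv 2 (legendreP l) (Real.cos φ) * Real.sin φ ^ 2| ^ (4 - k)
            * Real.sin φ)
        ≤ C * (l : ℝ) ^ 6 := by
  intro k hk
  have hk' : 1 ≤ k ∧ k ≤ 4 := by
    simp only [Set.mem_insert_iff, Set.mem_singleton_iff] at hk
    omega
  refine ⟨4 * 22 ^ 4 * 2, by norm_num, 2, ?_⟩
  intro l hl
  have hL : (2 : ℝ) ≤ l := by exact_mod_cast hl
  have e1 : deriv (legendreP l) = fun x => (Polynomial.derivative (legPoly l)).eval x := by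
    rw [legendreP_eq]; funext x; exact Polynomial.deriv _
  have e2 : iteratedDeriv 2 (legendreP l)
      = fun x => (Polynomial.derivative (Polynomial.derivative (legPoly l))).eval x := by
    rw [legendreP_eq, iteratedDeriv_polyEval]; rfl
  rw [e1, e2]
  have hcontg : Continuous fun φ : ℝ =>
      4 * 22 ^ 4 * (l : ℝ) ^ 7 * (1 + ((l : ℝ) * φ) ^ 2)⁻¹ := by
    refine continuous_const.mul (Continuous.inv₀ (by fun_prop) ?_)
    intro x; positivity
  calc _ ≤ ∫ φ in (0 : ℝ)..(π / 2), 4 * 22 ^ 4 * (l : ℝ) ^ 7 * (1 + ((l : ℝ) * φ) ^ 2)⁻¹ := by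
        refine intervalIntegral.integral_mono_on (by positivity) ?_
          (hcontg.intervalIntegrable _ _) ?_
        · apply Continuous.intervalIntegrable
          have c1 := (Polynomial.derivative (legPoly l)).continuous
          have c2 := (Polynomial.derivative (Polynomial.derivative (legPoly l))).continuous
          fun_prop
        · intro φ hφ
          exact integrand_bound k hk'.1 hk'.2 l hl φ hφ.1 hφ.2
    _ = 4 * 22 ^ 4 * (l : ℝ) ^ 6 * (l * ∫ φ in (0 : ℝ)..(π / 2), (1 + ((l : ℝ) * φ) ^ 2)⁻¹) := by
        rw [intervalIntegral.integral_const_mul]; ring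
    _ = 4 * 22 ^ 4 * (l : ℝ) ^ 6 * Real.arctan (l * (π / 2)) := by
        rw [intervalIntegral.mul_integral_comp_mul_left (f := fun x : ℝ => (1 + x ^ 2)⁻¹),
          integral_inv_one_add_sq]
        simp
    _ ≤ 4 * 22 ^ 4 * (l : ℝ) ^ 6 * 2 := by
        gcongr
        have := Real.arctan_lt_pi_div_two (l * (π / 2))
        linarith [Real.pi_lt_four]
    _ = _ := by ring
end

section
/- Fix a constant C > 0. Then as ℓ → ∞ over positive integers, ∫_{C/ℓ}^{π/2} cos²((2ℓ+1)φ)/sin φ dφ = (1/2)·log ℓ + O(1). -/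
open Real

lemma aux_main (a N : ℝ) (ha : 0 < a) (ha1 : a ≤ 1) (hN : 0 < N) :
    |(∫ x in a..(π / 2), (1 + Real.cos (N * x)) / 2 / Real.sin x)
      - (1 / 2) * (Real.log (Real.cos (a / 2)) - Real.log (Real.sin (a / 2)))|
      ≤ 2 / (N * Real.sin a) := by
  have hpi : (3 : ℝ) < π := Real.pi_gt_three
  have hab : a ≤ π / 2 := by linarith
  have hs : ∀ x ∈ Set.Icc a (π / 2), 0 < Real.sin x := fun x hx =>
    Real.sin_pos_of_pos_of_lt_pi (by linarith [hx.1]) (by linarith [hx.2])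
  have hs2 : ∀ x ∈ Set.Icc a (π / 2), 0 < Real.sin (x / 2) := fun x hx =>
    Real.sin_pos_of_pos_of_lt_pi (by linarith [hx.1]) (by linarith [hx.2])
  have hc2 : ∀ x ∈ Set.Icc a (π / 2), 0 < Real.cos (x / 2) := fun x hx =>
    Real.cos_pos_of_mem_Ioo ⟨by linarith [hx.1], by linarith [hx.2]⟩
  have hc : ∀ x ∈ Set.Icc a (π / 2), 0 ≤ Real.cos x := fun x hx =>
    Real.cos_nonneg_of_mem_Icc ⟨by linarith [hx.1], by linarith [hx.2]⟩
  have hu : Set.uIcc a (π / 2) = Set.Icc a (π / 2) := Set.uIcc_of_le hab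
  have hcont1 : ContinuousOn (fun x => (1 + Real.cos (N * x)) / 2 / Real.sin x)
      (Set.uIcc a (π / 2)) := by
    rw [hu]
    exact ContinuousOn.div (by fun_prop) (by fun_prop) (fun x hx => (hs x hx).ne')
  have hcont2 : ContinuousOn
      (fun x => Real.sin (N * x) * Real.cos x / (2 * N * Real.sin x ^ 2))
      (Set.uIcc a (π / 2)) := by
    rw [hu]
    refine ContinuousOn.div (by fun_prop) (by fun_prop) (fun x hx => ?_)
    have := hs x hx
    positivity
  have hcont3 : ContinuousOn
      (fun x => Real.cos x / (2 * N * Real.sin x ^ 2))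
      (Set.uIcc a (π / 2)) := by
    rw [hu]
    refine ContinuousOn.div (by fun_prop) (by fun_prop) (fun x hx => ?_)
    have := hs x hx
    positivity
  have hd3 : ∀ x ∈ Set.uIcc a (π / 2),
      HasDerivAt (fun x => -(1 / (2 * N)) * (Real.sin x)⁻¹)
        (Real.cos x / (2 * N * Real.sin x ^ 2)) x := by
    rw [hu]
    intro x hx
    have h0 := hs x hx
    refine HasDerivAt.congr_deriv (((Real.hasDerivAt_sin x).inv h0.ne').const_mul (-(1 / (2 * N)))) ?_
    field_simp
  have hI3 := intervalIntegral.integral_eq_sub_of_hasDerivAt hd3 hcont3.intervalIntegrable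
  have hd1 : ∀ x ∈ Set.uIcc a (π / 2),
      HasDerivAt (fun x => (1 / 2) * (Real.log (Real.sin (x / 2)) - Real.log (Real.cos (x / 2)))
          + (1 / (2 * N)) * (Real.sin (N * x) / Real.sin x))
        ((1 + Real.cos (N * x)) / 2 / Real.sin x
          - Real.sin (N * x) * Real.cos x / (2 * N * Real.sin x ^ 2)) x := by
    rw [hu]
    intro x hx
    have h0 := hs x hx
    have h1 := hs2 x hx
    have h2 := hc2 x hx
    have hh : HasDerivAt (fun x : ℝ => x / 2) (1 / 2) x := (hasDerivAt_id x).div_const 2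
    have hNx : HasDerivAt (fun x : ℝ => N * x) N x := by
      simpa using (hasDerivAt_id x).const_mul N
    have e1 := ((hh.sin.log h1.ne').sub (hh.cos.log h2.ne')).const_mul (1 / 2)
    have e2 := (hNx.sin.div (Real.hasDerivAt_sin x) h0.ne').const_mul (1 / (2 * N))
    refine HasDerivAt.congr_deriv (e1.add e2) ?_
    have hsx : Real.sin x = 2 * Real.sin (x / 2) * Real.cos (x / 2) := by
      rw [← Real.sin_two_mul]; congr 1; ring
    have key : Real.cos (x / 2) * (1 / 2) / Real.sin (x / 2)
        - -Real.sin (x / 2) * (1 / 2) / Real.cos (x / 2) = 1 / Real.sin x := by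
      rw [hsx]
      have := Real.sin_sq_add_cos_sq (x / 2)
      field_simp
      linarith
    rw [key]
    field_simp
    ring
  have hI1 := intervalIntegral.integral_eq_sub_of_hasDerivAt hd1
    (hcont1.sub hcont2).intervalIntegrable
  rw [intervalIntegral.integral_sub hcont1.intervalIntegrable hcont2.intervalIntegrable] at hI1
  have hb := intervalIntegral.norm_integral_le_of_norm_le (μ := MeasureTheory.volume)
    (f := fun x => Real.sin (N * x) * Real.cos x / (2 * N * Real.sin x ^ 2)) hab
    (g := fun x => Real.cos x / (2 * N * Real.sin x ^ 2))
    (Filter.Eventually.of_forall (fun x hx => by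
      have hx' : x ∈ Set.Icc a (π / 2) := ⟨hx.1.le, hx.2⟩
      have h0 := hs x hx'
      have h1 := hc x hx'
      rw [Real.norm_eq_abs, abs_div, abs_mul, abs_of_nonneg h1,
        abs_of_pos (by positivity : 0 < 2 * N * Real.sin x ^ 2)]
      gcongr
      exact mul_le_of_le_one_left h1 (Real.abs_sin_le_one _)))
    hcont3.intervalIntegrable
  rw [hI3, Real.norm_eq_abs] at hb
  have h4 : Real.sin (π / 2 / 2) = Real.cos (π / 2 / 2) := by
    rw [show π / 2 / 2 = π / 4 by ring, Real.sin_pi_div_four, Real.cos_pi_div_four]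
  rw [h4, sub_self] at hI1
  simp only [Real.sin_pi_div_two, div_one, inv_one, mul_one] at hI1 hb
  have hsa : 0 < Real.sin a := hs a ⟨le_rfl, hab⟩
  have hsa1 : Real.sin a ≤ 1 := Real.sin_le_one a
  set t := 1 / (2 * N) with ht
  have htp : 0 < t := by positivity
  have hinv : 1 ≤ (Real.sin a)⁻¹ := (one_le_inv₀ hsa).2 hsa1
  have hF : |t * (Real.sin (N * a) / Real.sin a)| ≤ t * (Real.sin a)⁻¹ := by
    rw [abs_mul, abs_of_pos htp, abs_div, abs_of_pos hsa, div_eq_mul_inv]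
    gcongr
    exact mul_le_of_le_one_left (by positivity) (Real.abs_sin_le_one _)
  have hG : |t * Real.sin (N * (π / 2))| ≤ t := by
    rw [abs_mul, abs_of_pos htp]
    exact mul_le_of_le_one_right htp.le (Real.abs_sin_le_one _)
  have hR : 2 / (N * Real.sin a) = 4 * (t * (Real.sin a)⁻¹) := by
    rw [ht]; field_simp; norm_num
  have hti : t ≤ t * (Real.sin a)⁻¹ := le_mul_of_one_le_right htp.le hinv
  rw [hR]
  rw [abs_le] at *
  constructor <;> linarith [hF.1, hF.2, hG.1, hG.2, hb.1, hb.2]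

/-- For fixed `C > 0`: as `ℓ → ∞`,
`∫_{C/ℓ}^{π/2} cos²((2ℓ+1)φ)/sin φ dφ = (1/2)·log ℓ + O(1)`. -/
theorem integral_cos_sq_div_sin_asymp (C : ℝ) (hC : 0 < C) :
    ∃ K > (0 : ℝ), ∃ l₀ : ℕ, ∀ l : ℕ, l₀ ≤ l →
      |(∫ φ in (C / (l : ℝ))..(π / 2),
          Real.cos ((2 * (l : ℝ) + 1) * φ) ^ 2 / Real.sin φ)
        - (1 / 2) * Real.log l| ≤ K := by
  have hpi : (3 : ℝ) < π := Real.pi_gt_three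
  refine ⟨π / (4 * C) + |Real.log (C / π)| + |Real.log C|, by positivity, ⌈C⌉₊ + 1, ?_⟩
  intro l hl
  have hlC : C ≤ l := by
    have h1 : C ≤ (⌈C⌉₊ : ℝ) := Nat.le_ceil C
    have h2 : ((⌈C⌉₊ + 1 : ℕ) : ℝ) ≤ l := by exact_mod_cast hl
    push_cast at h2
    linarith
  have hl0 : (0 : ℝ) < l := by linarith
  have ha1 : C / (l : ℝ) ≤ 1 := (div_le_one hl0).2 hlC
  have ha : 0 < C / (l : ℝ) := by positivity
  have hla : (l : ℝ) * (C / l) = C := by field_simp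
  have hm := aux_main (C / l) (2 * (2 * (l : ℝ) + 1)) ha ha1 (by positivity)
  have hfun : (fun x : ℝ => (1 + Real.cos (2 * (2 * (l : ℝ) + 1) * x)) / 2 / Real.sin x)
      = fun x => Real.cos ((2 * (l : ℝ) + 1) * x) ^ 2 / Real.sin x := by
    funext x
    rw [Real.cos_sq, mul_assoc]
    ring
  rw [hfun] at hm
  set a := C / (l : ℝ) with hadef
  have hsin : 2 / π * a ≤ Real.sin a := Real.mul_le_sin ha.le (by linarith)
  have hsin2 : 2 / π * (a / 2) ≤ Real.sin (a / 2) := Real.mul_le_sin (by linarith) (by linarith)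
  have hsin3 : Real.sin (a / 2) ≤ a / 2 := Real.sin_le (by linarith)
  have hcos : 1 / 2 ≤ Real.cos (a / 2) := by
    have := Real.one_sub_sq_div_two_le_cos (x := a / 2)
    nlinarith
  have hcos1 := Real.cos_le_one (a / 2)
  have hc0 : 0 < Real.cos (a / 2) := by linarith
  have hs0 : 0 < Real.sin (a / 2) := lt_of_lt_of_le (by positivity) hsin2
  have hbound : 2 / (2 * (2 * (l : ℝ) + 1) * Real.sin a) ≤ π / (4 * C) := by
    have h1 : 4 * (l : ℝ) * (2 / π * a) ≤ 2 * (2 * (l : ℝ) + 1) * Real.sin a := by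
      exact mul_le_mul (by linarith) hsin (by positivity) (by positivity)
    have h2 : 4 * (l : ℝ) * (2 / π * a) = 8 * C / π := by
      rw [← hla]; ring
    rw [h2] at h1
    calc 2 / (2 * (2 * (l : ℝ) + 1) * Real.sin a) ≤ 2 / (8 * C / π) := by gcongr
      _ = π / (4 * C) := by field_simp; norm_num
  have hlog : Real.log ((l : ℝ) * Real.sin (a / 2) / Real.cos (a / 2))
      = Real.log l + Real.log (Real.sin (a / 2)) - Real.log (Real.cos (a / 2)) := by
    rw [Real.log_div (by positivity) hc0.ne', Real.log_mul hl0.ne' hs0.ne']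
  have hlo : C / π ≤ (l : ℝ) * Real.sin (a / 2) / Real.cos (a / 2) := by
    rw [le_div_iff₀ hc0]
    calc C / π * Real.cos (a / 2) ≤ C / π := mul_le_of_le_one_right (by positivity) hcos1
      _ = l * (2 / π * (a / 2)) := by rw [← hla]; ring
      _ ≤ _ := by gcongr
  have hup : (l : ℝ) * Real.sin (a / 2) / Real.cos (a / 2) ≤ C := by
    rw [div_le_iff₀ hc0]
    calc (l : ℝ) * Real.sin (a / 2) ≤ l * (a / 2) := by gcongr
      _ = C * (1 / 2) := by rw [← hla]; ring
      _ ≤ _ := by gcongr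
  have hL1 := Real.log_le_log (by positivity) hlo
  have hL2 := Real.log_le_log (by positivity) hup
  rw [hlog] at hL1 hL2
  have n1 := neg_abs_le (Real.log (C / π))
  have n2 := le_abs_self (Real.log C)
  have n3 := abs_nonneg (Real.log (C / π))
  have n4 := abs_nonneg (Real.log C)
  obtain ⟨m1, m2⟩ := abs_le.1 hm
  rw [abs_le]
  constructor <;> linarith
end
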